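/- arXiv:1009.1670 — 10 statements merged into one kernel-verified Lean document; each statement's English description precedes it below -/
import Mathlib

section
/- Let e, f, g be continuously differentiable (e : ℝⁿ → ℝⁿ, f : ℝⁿ×ℝᵐ → ℝⁿ, g : ℝⁿ×ℝᵐ → ℝᵏ) and let Q be a symmetric positive definite n×n matrix. Assume e has a continuously differentiable inverse e⁻ (e⁻(e(x)) = e(e⁻(x)) = x for all x), and assume that for every x ∈ ℝⁿ and u ∈ ℝᵐ the quadratic form σ(Δ) := |F(x,u)Δ|²_Q − |E(x)Δ|²_Q + |G(x,u)Δ|² is bounded above over Δ ∈ ℝⁿ (equivalently, the local RIE 𝓔⁰_Q(e⁻(f(x,u)), x, u, g(x,u)) is finite for every (x,u)). Then the discrete-time system e(x(t+1)) = f(x(t),u(t)), y(t) = g(x(t),u(t)) is globally incrementally output ℓ₂-stable: for every two solutions (u, x₀, y₀) and (u, x₁, y₁) with the same input u, the sequence {y₁(t) − y₀(t)}ₜ is square summable, i.e. Σ_{t=1}^{∞} |y₁(t) − y₀(t)|² < ∞. -/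
open Matrix

/-- `|a|²_Q = aᵀ Q a`. -/
noncomputable def quadForm {n : ℕ} (Q : Matrix (Fin n) (Fin n) ℝ) (a : Fin n → ℝ) : ℝ :=
  a ⬝ᵥ Q.mulVec a

lemma aux_dot_deriv {n : ℕ} (c : Fin n → ℝ) {h : ℝ → Fin n → ℝ} {h' : Fin n → ℝ} {s : ℝ}
    (H : HasDerivAt h h' s) : HasDerivAt (fun t => c ⬝ᵥ h t) (c ⬝ᵥ h') s := by
  unfold dotProduct
  exact HasDerivAt.fun_sum fun i _ => ((hasDerivAt_pi.1 H) i).const_mul (c i)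

lemma aux_quad_nonneg {n : ℕ} {Q : Matrix (Fin n) (Fin n) ℝ} (hQ : Q.PosDef)
    (a : Fin n → ℝ) : 0 ≤ quadForm Q a := by
  simpa [quadForm] using hQ.posSemidef.dotProduct_mulVec_nonneg a

lemma aux_quad_young {n : ℕ} {Q : Matrix (Fin n) (Fin n) ℝ} (hQ : Q.PosDef)
    (a p : Fin n → ℝ) : 2 * (Q.mulVec a ⬝ᵥ p) ≤ quadForm Q a + quadForm Q p := by
  have h := aux_quad_nonneg hQ (a - p)
  have hs : Qᵀ = Q := by simpa using hQ.isHermitian.eq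
  have h1 : a ⬝ᵥ Q.mulVec p = Q.mulVec a ⬝ᵥ p := by
    rw [dotProduct_mulVec, ← mulVec_transpose, hs]
  have h2 : p ⬝ᵥ Q.mulVec a = Q.mulVec a ⬝ᵥ p := dotProduct_comm _ _
  simp only [quadForm, mulVec_sub, sub_dotProduct, dotProduct_sub] at *
  linarith

lemma aux_dot_young {n : ℕ} (a p : Fin n → ℝ) : 2 * (a ⬝ᵥ p) ≤ a ⬝ᵥ a + p ⬝ᵥ p := by
  have h : 0 ≤ (a - p) ⬝ᵥ (a - p) := Finset.sum_nonneg fun i _ => mul_self_nonneg _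
  have h2 : p ⬝ᵥ a = a ⬝ᵥ p := dotProduct_comm _ _
  simp only [sub_dotProduct, dotProduct_sub] at *
  linarith

lemma aux_homog {V : Type*} [AddCommGroup V] [Module ℝ V] (σ : V → ℝ)
    (hσ : ∀ (c : ℝ) v, σ (c • v) = c ^ 2 * σ v) (hb : BddAbove (Set.range σ)) (v : V) :
    σ v ≤ 0 := by
  by_contra! hv
  obtain ⟨B, hB⟩ := hb
  have h1 : ∀ c : ℝ, c ^ 2 * σ v ≤ B := fun c => hσ c v ▸ hB ⟨c • v, rfl⟩
  have h2 := h1 (B / σ v + 1)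
  have h3 := h1 0
  have h4 : 0 ≤ B := by simpa using h3
  have h5 : B / σ v * σ v = B := div_mul_cancel₀ _ hv.ne'
  have h6 : 0 ≤ B / σ v := by positivity
  nlinarith [mul_nonneg (sq_nonneg (B / σ v)) hv.le]

/-- Theorem 3 (discrete time): global finiteness of the local RIE implies global
incremental output ℓ₂-stability of the model
`e(x(t+1)) = f(x(t),u(t)), y(t) = g(x(t),u(t))`. -/
theorem finite_local_RIE_implies_incremental_l2_stability_dt
    {n m k : ℕ} (Q : Matrix (Fin n) (Fin n) ℝ) (hQ : Q.PosDef)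
    (e einv : (Fin n → ℝ) → (Fin n → ℝ))
    (f : (Fin n → ℝ) → (Fin m → ℝ) → (Fin n → ℝ))
    (g : (Fin n → ℝ) → (Fin m → ℝ) → (Fin k → ℝ))
    (he : ContDiff ℝ 1 e) (heinv : ContDiff ℝ 1 einv)
    (hinv₁ : ∀ ξ, einv (e ξ) = ξ) (hinv₂ : ∀ ξ, e (einv ξ) = ξ)
    (hf : ContDiff ℝ 1 (fun p : (Fin n → ℝ) × (Fin m → ℝ) => f p.1 p.2))
    (hg : ContDiff ℝ 1 (fun p : (Fin n → ℝ) × (Fin m → ℝ) => g p.1 p.2))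
    -- Jacobians of `e`, `f`, `g` with respect to the state
    (E : (Fin n → ℝ) → Matrix (Fin n) (Fin n) ℝ)
    (F : (Fin n → ℝ) → (Fin m → ℝ) → Matrix (Fin n) (Fin n) ℝ)
    (G : (Fin n → ℝ) → (Fin m → ℝ) → Matrix (Fin k) (Fin n) ℝ)
    (hE : ∀ ξ, HasFDerivAt e (LinearMap.toContinuousLinearMap (Matrix.mulVecLin (E ξ))) ξ)
    (hF : ∀ ξ υ, HasFDerivAt (fun ζ => f ζ υ)
      (LinearMap.toContinuousLinearMap (Matrix.mulVecLin (F ξ υ))) ξ)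
    (hG : ∀ ξ υ, HasFDerivAt (fun ζ => g ζ υ)
      (LinearMap.toContinuousLinearMap (Matrix.mulVecLin (G ξ υ))) ξ)
    -- finiteness of the local RIE at every `(x, u)`: the quadratic form
    -- `σ(Δ) = |F(x,u)Δ|²_Q − |E(x)Δ|²_Q + |G(x,u)Δ|²` is bounded above
    (hfin : ∀ (ξ : Fin n → ℝ) (υ : Fin m → ℝ),
      BddAbove (Set.range fun Δ : Fin n → ℝ =>
        quadForm Q ((F ξ υ).mulVec Δ) - quadForm Q ((E ξ).mulVec Δ)
          + ((G ξ υ).mulVec Δ) ⬝ᵥ ((G ξ υ).mulVec Δ)))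
    -- two solutions of the model with the same input `u`
    (u : ℕ → Fin m → ℝ)
    (x0 x1 : ℕ → Fin n → ℝ) (y0 y1 : ℕ → Fin k → ℝ)
    (hx0 : ∀ t, e (x0 (t + 1)) = f (x0 t) (u t))
    (hy0 : ∀ t, y0 t = g (x0 t) (u t))
    (hx1 : ∀ t, e (x1 (t + 1)) = f (x1 t) (u t))
    (hy1 : ∀ t, y1 t = g (x1 t) (u t)) :
    Summable (fun t : ℕ => (y1 t - y0 t) ⬝ᵥ (y1 t - y0 t)) := by
  have hσ : ∀ ξ υ Δ, quadForm Q ((F ξ υ).mulVec Δ) - quadForm Q ((E ξ).mulVec Δ)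
          + ((G ξ υ).mulVec Δ) ⬝ᵥ ((G ξ υ).mulVec Δ) ≤ 0 := by
    intro ξ υ Δ
    refine aux_homog (fun Δ : Fin n → ℝ =>
        quadForm Q ((F ξ υ).mulVec Δ) - quadForm Q ((E ξ).mulVec Δ)
          + ((G ξ υ).mulVec Δ) ⬝ᵥ ((G ξ υ).mulVec Δ)) ?_ (hfin ξ υ) Δ
    intro c v
    simp only [quadForm, mulVec_smul, smul_dotProduct, dotProduct_smul, smul_eq_mul]
    ring
  have key : ∀ (υ : Fin m → ℝ) (z0 z1 : Fin n → ℝ),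
      quadForm Q (f (einv z1) υ - f (einv z0) υ)
        + (g (einv z1) υ - g (einv z0) υ) ⬝ᵥ (g (einv z1) υ - g (einv z0) υ)
        ≤ quadForm Q (z1 - z0) := by
    intro υ z0 z1
    set a := f (einv z1) υ - f (einv z0) υ with ha
    set b := g (einv z1) υ - g (einv z0) υ with hb
    set v := z1 - z0 with hv
    let γ : ℝ → Fin n → ℝ := fun s => z0 + s • v
    let w : ℝ → Fin n → ℝ := fun s => fderiv ℝ einv (γ s) v
    have hγ : ∀ s, HasDerivAt γ v s := fun s => by
      have h := ((hasDerivAt_id s).smul_const v).const_add z0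
      rw [one_smul] at h
      exact h
    have hei : ∀ s, HasDerivAt (fun s => einv (γ s)) (w s) s := fun s =>
      ((heinv.differentiable one_ne_zero (γ s)).hasFDerivAt).comp_hasDerivAt s (hγ s)
    have hEw : ∀ s, (E (einv (γ s))).mulVec (w s) = v := fun s => by
      have h1 := (hE (einv (γ s))).comp_hasDerivAt s (hei s)
      have h2 : (e ∘ fun s => einv (γ s)) = γ := by funext s; simp [hinv₂]
      rw [h2] at h1
      simpa using h1.unique (hγ s)
    have hFw : ∀ s, HasDerivAt (fun s => f (einv (γ s)) υ)
        ((F (einv (γ s)) υ).mulVec (w s)) s := fun s => by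
      have h1 := (hF (einv (γ s)) υ).comp_hasDerivAt s (hei s)
      simpa [Function.comp_def] using h1
    have hGw : ∀ s, HasDerivAt (fun s => g (einv (γ s)) υ)
        ((G (einv (γ s)) υ).mulVec (w s)) s := fun s => by
      have h1 := (hG (einv (γ s)) υ).comp_hasDerivAt s (hei s)
      simpa [Function.comp_def] using h1
    have hφ := fun s => (aux_dot_deriv (Q.mulVec a) (hFw s)).fun_add (aux_dot_deriv b (hGw s))
    obtain ⟨s, -, hs⟩ := exists_hasDerivAt_eq_slope _ _ (zero_lt_one (α := ℝ))
      (fun s _ => (hφ s).continuousAt.continuousWithinAt) (fun s _ => hφ s)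
    have g0 : γ 0 = z0 := by simp [γ]
    have g1 : γ 1 = z1 := by simp [γ, hv]
    rw [g0, g1] at hs
    have hN : Q.mulVec a ⬝ᵥ a = quadForm Q a := dotProduct_comm _ _
    have e1 : Q.mulVec a ⬝ᵥ a = Q.mulVec a ⬝ᵥ f (einv z1) υ - Q.mulVec a ⬝ᵥ f (einv z0) υ := by
      rw [← dotProduct_sub]
    have e2 : b ⬝ᵥ b = b ⬝ᵥ g (einv z1) υ - b ⬝ᵥ g (einv z0) υ := by
      rw [← dotProduct_sub]
    have y1 := aux_quad_young hQ a ((F (einv (γ s)) υ).mulVec (w s))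
    have y2 := aux_dot_young b ((G (einv (γ s)) υ).mulVec (w s))
    have y3 := hσ (einv (γ s)) υ (w s)
    rw [hEw s] at y3
    simp only [sub_zero, div_one] at hs
    linarith
  have step : ∀ t, quadForm Q (e (x1 (t+1)) - e (x0 (t+1))) + (y1 t - y0 t) ⬝ᵥ (y1 t - y0 t)
      ≤ quadForm Q (e (x1 t) - e (x0 t)) := fun t => by
    have := key (u t) (e (x0 t)) (e (x1 t))
    rwa [hinv₁, hinv₁, ← hx0, ← hx1, ← hy0, ← hy1] at this
  refine summable_of_sum_range_le (c := quadForm Q (e (x1 0) - e (x0 0)))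
    (fun t => Finset.sum_nonneg fun i _ => mul_self_nonneg _) fun N => ?_
  have : ∀ N, ∑ t ∈ Finset.range N, (y1 t - y0 t) ⬝ᵥ (y1 t - y0 t)
      + quadForm Q (e (x1 N) - e (x0 N)) ≤ quadForm Q (e (x1 0) - e (x0 0)) := by
    intro N
    induction N with
    | zero => simp
    | succ N ih => rw [Finset.sum_range_succ]; linarith [step N]
  linarith [this N, aux_quad_nonneg hQ (e (x1 N) - e (x0 N))]
end

section
/- Let e : ℝⁿ → ℝⁿ be continuously differentiable with Jacobian E(x) uniformly bounded in operator norm, and suppose there exists r₀ > 0 such that E(x) + E(x)ᵀ ⪰ 2r₀ I for all x ∈ ℝⁿ. Then e is a bijection from ℝⁿ to ℝⁿ. -/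
open Matrix

theorem zarantonello_aux {H : Type*} [NormedAddCommGroup H] [InnerProductSpace ℝ H]
    [CompleteSpace H] (f : H → H) (L : NNReal) (hL : LipschitzWith L f) (r : ℝ) (hr : 0 < r)
    (hm : ∀ x y, r * ‖x - y‖ ^ 2 ≤ inner ℝ (f x - f y) (x - y)) : Function.Bijective f := by
  constructor
  · intro x y hxy
    have h := hm x y
    rw [hxy, sub_self, inner_zero_left] at h
    have h2 : ‖x - y‖ ^ 2 ≤ 0 := by
      by_contra hc
      push Not at hc
      have := mul_pos hr hc
      linarith
    have h3 : ‖x - y‖ = 0 := by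
      have := sq_nonneg ‖x - y‖
      exact pow_eq_zero_iff (two_ne_zero) |>.1 (le_antisymm h2 this)
    exact sub_eq_zero.1 (norm_eq_zero.1 h3)
  · intro b
    set M : ℝ := L + r with hM
    have hL0 : (0 : ℝ) ≤ L := L.2
    have hMp : 0 < M := by positivity
    have hMr : r ≤ M := by linarith
    set t : ℝ := r / M ^ 2 with ht
    have htp : 0 < t := by positivity
    have htM : t * M ^ 2 = r := by rw [ht]; field_simp
    have hq0 : 0 ≤ 1 - t * r := by
      have : t * r ≤ 1 := by
        rw [ht, div_mul_eq_mul_div, div_le_one (by positivity)]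
        nlinarith
      linarith
    have hq1 : 1 - t * r < 1 := by nlinarith [mul_pos htp hr]
    have hc : ContractingWith (Real.sqrt (1 - t * r)).toNNReal (fun x => x - t • (f x - b)) := by
      constructor
      · rw [Real.toNNReal_lt_one, Real.sqrt_lt' one_pos]
        simpa using hq1
      · apply LipschitzWith.of_dist_le_mul
        intro x y
        rw [Real.coe_toNNReal _ (Real.sqrt_nonneg _), dist_eq_norm, dist_eq_norm]
        refine (sq_le_sq₀ (norm_nonneg _) (by positivity)).1 ?_
        rw [mul_pow, Real.sq_sqrt hq0]
        have h1 : x - t • (f x - b) - (y - t • (f y - b)) = (x - y) - t • (f x - f y) := by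
          module
        have h2 : ‖f x - f y‖ ≤ M * ‖x - y‖ := by
          have := hL.dist_le_mul x y
          rw [dist_eq_norm, dist_eq_norm] at this
          nlinarith [norm_nonneg (x - y)]
        have h3 : ‖f x - f y‖ ^ 2 ≤ M ^ 2 * ‖x - y‖ ^ 2 := by
          rw [← mul_pow]; gcongr
        rw [h1, norm_sub_sq_real, inner_smul_right, norm_smul, real_inner_comm, mul_pow,
          Real.norm_of_nonneg htp.le]
        have h4 := mul_le_mul_of_nonneg_left (hm x y) htp.le
        have h5 := mul_le_mul_of_nonneg_left h3 (sq_nonneg t)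
        have h6 : t ^ 2 * (M ^ 2 * ‖x - y‖ ^ 2) = t * r * ‖x - y‖ ^ 2 := by
          rw [← htM]; ring
        nlinarith
    obtain ⟨p, hp⟩ : ∃ p, Function.IsFixedPt (fun x => x - t • (f x - b)) p :=
      ⟨_, hc.fixedPoint_isFixedPt⟩
    refine ⟨p, ?_⟩
    have h : t • (f p - b) = 0 := sub_eq_self.1 hp.eq
    exact sub_eq_zero.1 ((smul_eq_zero.1 h).resolve_left htp.ne')

theorem mono_aux {n : ℕ} (e : (Fin n → ℝ) → (Fin n → ℝ))
    (E : (Fin n → ℝ) → Matrix (Fin n) (Fin n) ℝ)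
    (hE : ∀ ξ, HasFDerivAt e (LinearMap.toContinuousLinearMap (Matrix.mulVecLin (E ξ))) ξ)
    (r₀ : ℝ)
    (hmono : ∀ ξ, (E ξ + (E ξ)ᵀ - (2 * r₀) • (1 : Matrix (Fin n) (Fin n) ℝ)).PosSemidef)
    (x y : Fin n → ℝ) : r₀ * ((x - y) ⬝ᵥ (x - y)) ≤ (x - y) ⬝ᵥ (e x - e y) := by
  set v := x - y with hv
  have hq : ∀ ξ, r₀ * (v ⬝ᵥ v) ≤ v ⬝ᵥ (E ξ *ᵥ v) := by
    intro ξ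
    have h := (hmono ξ).dotProduct_mulVec_nonneg v
    have h2 : v ⬝ᵥ ((E ξ)ᵀ *ᵥ v) = v ⬝ᵥ (E ξ *ᵥ v) := by
      rw [Matrix.mulVec_transpose, dotProduct_comm, Matrix.dotProduct_mulVec]
    rw [star_trivial, Matrix.sub_mulVec, Matrix.add_mulVec, dotProduct_sub, dotProduct_add, h2,
      Matrix.smul_mulVec, Matrix.one_mulVec, dotProduct_smul, smul_eq_mul] at h
    linarith
  have hd : ∀ s : ℝ, HasDerivAt (fun s : ℝ => v ⬝ᵥ e (y + s • v) - r₀ * (v ⬝ᵥ v) * s)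
      (v ⬝ᵥ (E (y + s • v) *ᵥ v) - r₀ * (v ⬝ᵥ v)) s := by
    intro s
    have h1 : HasDerivAt (fun s : ℝ => y + s • v) v s := by
      simpa using ((hasDerivAt_id s).smul_const v).const_add y
    have h2 := (hE (y + s • v)).comp_hasDerivAt s h1
    have h3 : HasDerivAt (fun s : ℝ => v ⬝ᵥ e (y + s • v)) (v ⬝ᵥ (E (y + s • v) *ᵥ v)) s := by
      have h4 := hasDerivAt_pi.1 h2
      unfold dotProduct
      exact HasDerivAt.fun_sum fun i _ => (h4 i).const_mul (v i)
    simpa using h3.fun_sub ((hasDerivAt_id s).const_mul (r₀ * (v ⬝ᵥ v)))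
  have hmon := monotone_of_hasDerivAt_nonneg hd (fun s => sub_nonneg.2 (hq _))
  have := hmon (zero_le_one)
  simp only [one_smul, zero_smul, add_zero, mul_zero, mul_one, sub_zero] at this
  rw [hv, add_sub_cancel, ← hv] at this
  rw [dotProduct_sub v (e x) (e y)]
  linarith

/-- Theorem 4: a continuously differentiable map `e : ℝⁿ → ℝⁿ` with uniformly
bounded Jacobian `E(x)` satisfying `E(x) + E(x)ᵀ ⪰ 2r₀ I` for some `r₀ > 0`
is a bijection. -/
theorem strongly_monotone_bounded_jacobian_bijective
    {n : ℕ} (e : (Fin n → ℝ) → (Fin n → ℝ))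
    (E : (Fin n → ℝ) → Matrix (Fin n) (Fin n) ℝ)
    (he : ContDiff ℝ 1 e)
    (hE : ∀ ξ, HasFDerivAt e (LinearMap.toContinuousLinearMap (Matrix.mulVecLin (E ξ))) ξ)
    -- the Jacobian is uniformly bounded in operator norm
    (hbdd : ∃ c : ℝ, ∀ ξ,
      ‖LinearMap.toContinuousLinearMap (Matrix.mulVecLin (E ξ))‖ ≤ c)
    (r₀ : ℝ) (hr₀ : 0 < r₀)
    (hmono : ∀ ξ, (E ξ + (E ξ)ᵀ - (2 * r₀) • (1 : Matrix (Fin n) (Fin n) ℝ)).PosSemidef) :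
    Function.Bijective e := by
  obtain ⟨c, hc⟩ := hbdd
  have hLip : LipschitzWith c.toNNReal e := by
    apply lipschitzWith_of_nnnorm_fderiv_le (𝕜 := ℝ) (fun x => (hE x).differentiableAt)
    intro x
    rw [(hE x).fderiv, ← NNReal.coe_le_coe, coe_nnnorm]
    exact (hc x).trans (Real.le_coe_toNNReal c)
  let Φ := EuclideanSpace.equiv (Fin n) ℝ
  have hb : Function.Bijective (Φ.symm ∘ e ∘ Φ) := by
    refine zarantonello_aux _ _ (Φ.symm.lipschitz.comp (hLip.comp Φ.lipschitz)) r₀ hr₀ ?_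
    intro x y
    have h := mono_aux e E hE r₀ hmono (Φ x) (Φ y)
    rw [← real_inner_self_eq_norm_sq]
    simp only [EuclideanSpace.inner_eq_star_dotProduct, star_trivial]
    exact h
  have h2 : e = Φ ∘ (Φ.symm ∘ e ∘ Φ) ∘ Φ.symm := by
    funext x; simp
  rw [h2]
  exact Φ.bijective.comp (hb.comp Φ.symm.bijective)
end

section
/- Let e : ℝⁿ → ℝⁿ be continuously differentiable and suppose there exists r₀ > 0 such that E(x) + E(x)ᵀ ⪰ 2r₀ I for all x ∈ ℝⁿ, where E(x) is the Jacobian of e at x. Then |e(x + Δ) − e(x)| ≥ r₀ |Δ| for all x, Δ ∈ ℝⁿ; in particular e is injective and |e(x)| → ∞ as |x| → ∞. -/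
open Matrix Filter

lemma aux_sqrt_dot {n : ℕ} (v : Fin n → ℝ) :
    Real.sqrt (v ⬝ᵥ v) = ‖WithLp.toLp 2 v‖ := by
  rw [EuclideanSpace.norm_eq]
  congr 1
  simp [dotProduct, sq]

lemma aux_cs {n : ℕ} (u v : Fin n → ℝ) :
    u ⬝ᵥ v ≤ Real.sqrt (u ⬝ᵥ u) * Real.sqrt (v ⬝ᵥ v) := by
  have h := Finset.sum_mul_sq_le_sq_mul_sq Finset.univ u v
  have hu : u ⬝ᵥ u = ∑ i, u i ^ 2 := by simp [dotProduct, sq]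
  have hv : v ⬝ᵥ v = ∑ i, v i ^ 2 := by simp [dotProduct, sq]
  rw [hu, hv, ← Real.sqrt_mul (Finset.sum_nonneg fun i _ => sq_nonneg _)]
  exact Real.le_sqrt_of_sq_le h

/-- If `e` is continuously differentiable with Jacobian `E(x)` satisfying
`E(x) + E(x)ᵀ ⪰ 2r₀ I` for some `r₀ > 0`, then
`|e(x+Δ) − e(x)| ≥ r₀|Δ|` for all `x, Δ`; in particular `e` is injective and
`|e(x)| → ∞` as `|x| → ∞` (Euclidean norms written via `√(v ⬝ᵥ v)`). -/
theorem strongly_monotone_jacobian_expansive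
    {n : ℕ} (e : (Fin n → ℝ) → (Fin n → ℝ))
    (E : (Fin n → ℝ) → Matrix (Fin n) (Fin n) ℝ)
    (he : ContDiff ℝ 1 e)
    (hE : ∀ ξ, HasFDerivAt e (LinearMap.toContinuousLinearMap (Matrix.mulVecLin (E ξ))) ξ)
    (r₀ : ℝ) (hr₀ : 0 < r₀)
    (hmono : ∀ ξ, (E ξ + (E ξ)ᵀ - (2 * r₀) • (1 : Matrix (Fin n) (Fin n) ℝ)).PosSemidef) :
    (∀ x Δ : Fin n → ℝ,
        r₀ * Real.sqrt (Δ ⬝ᵥ Δ)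
          ≤ Real.sqrt ((e (x + Δ) - e x) ⬝ᵥ (e (x + Δ) - e x)))
    ∧ Function.Injective e
    ∧ Tendsto (fun x : Fin n → ℝ => Real.sqrt (e x ⬝ᵥ e x))
        (Filter.comap (fun x : Fin n → ℝ => Real.sqrt (x ⬝ᵥ x)) Filter.atTop)
        Filter.atTop := by
  have hquad : ∀ ξ Δ : Fin n → ℝ, r₀ * (Δ ⬝ᵥ Δ) ≤ Δ ⬝ᵥ (E ξ *ᵥ Δ) := by
    intro ξ Δ
    have h := (hmono ξ).dotProduct_mulVec_nonneg Δ
    simp only [star_trivial, sub_mulVec, add_mulVec, smul_mulVec, one_mulVec, dotProduct_sub,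
      dotProduct_add, dotProduct_smul, smul_eq_mul] at h
    have h2 : Δ ⬝ᵥ ((E ξ)ᵀ *ᵥ Δ) = Δ ⬝ᵥ (E ξ *ᵥ Δ) := by
      rw [mulVec_transpose, dotProduct_comm, dotProduct_mulVec]
    linarith
  have hstrong : ∀ x Δ : Fin n → ℝ, r₀ * (Δ ⬝ᵥ Δ) ≤ Δ ⬝ᵥ (e (x + Δ) - e x) := by
    intro x Δ
    have hd : ∀ t : ℝ, HasDerivAt (fun t : ℝ => Δ ⬝ᵥ e (x + t • Δ))
        (Δ ⬝ᵥ (E (x + t • Δ) *ᵥ Δ)) t := by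
      intro t
      have h1 : HasDerivAt (fun t : ℝ => x + t • Δ) Δ t := by
        simpa using ((hasDerivAt_id t).smul_const Δ).const_add x
      have h2 := (hE (x + t • Δ)).comp_hasDerivAt t h1
      have h3 := hasDerivAt_pi.1 h2
      exact HasDerivAt.fun_sum fun i _ => (h3 i).const_mul (Δ i)
    obtain ⟨c, -, hc⟩ := exists_hasDerivAt_eq_slope (fun t : ℝ => Δ ⬝ᵥ e (x + t • Δ)) _
      (zero_lt_one' ℝ) (fun t _ => (hd t).continuousAt.continuousWithinAt) (fun t _ => hd t)
    have hq := hquad (x + c • Δ) Δ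
    rw [hc] at hq
    simpa [dotProduct_sub] using hq
  have hexp : ∀ x Δ : Fin n → ℝ,
        r₀ * Real.sqrt (Δ ⬝ᵥ Δ)
          ≤ Real.sqrt ((e (x + Δ) - e x) ⬝ᵥ (e (x + Δ) - e x)) := by
    intro x Δ
    have h := (hstrong x Δ).trans (aux_cs _ _)
    have hn : 0 ≤ Δ ⬝ᵥ Δ := Finset.sum_nonneg fun i _ => mul_self_nonneg _
    rcases (Real.sqrt_nonneg (Δ ⬝ᵥ Δ)).eq_or_lt with h0 | h0
    · rw [← h0, mul_zero]; exact Real.sqrt_nonneg _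
    · refine le_of_mul_le_mul_left ?_ h0
      calc _ = r₀ * (Real.sqrt (Δ ⬝ᵥ Δ) * Real.sqrt (Δ ⬝ᵥ Δ)) := by ring
        _ = r₀ * (Δ ⬝ᵥ Δ) := by rw [Real.mul_self_sqrt hn]
        _ ≤ _ := h
  refine ⟨hexp, ?_, ?_⟩
  · intro x y hxy
    have h := hstrong x (y - x)
    rw [add_sub_cancel, hxy, sub_self, dotProduct_zero] at h
    have hn : 0 ≤ (y - x) ⬝ᵥ (y - x) := Finset.sum_nonneg fun i _ => mul_self_nonneg _
    have h0 : (y - x) ⬝ᵥ (y - x) = 0 := by nlinarith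
    exact (sub_eq_zero.1 (dotProduct_self_eq_zero.1 h0)).symm
  · have hb : ∀ x, r₀ * Real.sqrt (x ⬝ᵥ x) + -Real.sqrt (e 0 ⬝ᵥ e 0) ≤ Real.sqrt (e x ⬝ᵥ e x) := by
      intro x
      have h := hexp 0 x
      rw [zero_add] at h
      have h2 : Real.sqrt ((e x - e 0) ⬝ᵥ (e x - e 0))
          ≤ Real.sqrt (e x ⬝ᵥ e x) + Real.sqrt (e 0 ⬝ᵥ e 0) := by
        simp only [aux_sqrt_dot, WithLp.toLp_sub]
        exact norm_sub_le _ _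
      linarith
    exact tendsto_atTop_mono hb
      (tendsto_atTop_add_const_right _ _ (tendsto_comap.const_mul_atTop hr₀))
end

section
/- Let Q be a symmetric positive definite n×n matrix and let e : ℝⁿ → ℝⁿ, f : ℝⁿ×ℝᵐ → ℝⁿ, g : ℝⁿ×ℝᵐ → ℝᵏ be continuously differentiable, with E(x) the Jacobian of e, invertible for all x. Let x̃ : [0,T] → ℝⁿ be continuously differentiable with ṽ(t) := (d/dt)x̃(t), and let ũ : [0,T] → ℝᵐ, ỹ : [0,T] → ℝᵏ be continuous. Let x : [0,T] → ℝⁿ be differentiable with (d/dt) e(x(t)) = f(x(t), ũ(t)) and x(0) = x̃(0), and let y(t) := g(x(t), ũ(t)). Then ∫₀ᵀ |ỹ(t) − y(t)|² dt ≤ ∫₀ᵀ 𝓔_Q(z̃(t)) dt in the extended reals, where z̃(t) = (ṽ(t), x̃(t), ũ(t), ỹ(t)) and 𝓔_Q is the continuous-time global RIE. -/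
open Matrix MeasureTheory ENNReal

/-- Continuous-time global robust identification error at the data point
`z̃ = (v, x, u, y)` (an extended-nonnegative value; the supremand is
nonnegative at `Δ = 0`, so no truncation occurs). -/
noncomputable def ctGlobalRIE {n m k : ℕ} (Q : Matrix (Fin n) (Fin n) ℝ)
    (e : (Fin n → ℝ) → (Fin n → ℝ)) (f : (Fin n → ℝ) → (Fin m → ℝ) → (Fin n → ℝ))
    (g : (Fin n → ℝ) → (Fin m → ℝ) → (Fin k → ℝ))
    (E : (Fin n → ℝ) → Matrix (Fin n) (Fin n) ℝ)
    (v x : Fin n → ℝ) (u : Fin m → ℝ) (yy : Fin k → ℝ) : ℝ≥0∞ :=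
  ⨆ Δ : Fin n → ℝ,
    ENNReal.ofReal
      (2 * ((e (x + Δ) - e x) ⬝ᵥ Q.mulVec (f (x + Δ) u - (E x).mulVec v))
        + (g (x + Δ) u - yy) ⬝ᵥ (g (x + Δ) u - yy))

theorem lintegral_aux (T : ℝ) (hT : 0 ≤ T) (V V' s : ℝ → ℝ) (R : ℝ → ℝ≥0∞)
    (hR : Measurable R)
    (hV : ∀ t ∈ Set.Icc (0 : ℝ) T, HasDerivWithinAt V (V' t) (Set.Icc (0 : ℝ) T) t)
    (hV0 : V 0 = 0) (hVT : 0 ≤ V T)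
    (hs : ∀ t, 0 ≤ s t)
    (hle : ∀ t, ENNReal.ofReal (V' t + s t) ≤ R t) :
    (∫⁻ t in Set.Ioc (0 : ℝ) T, ENNReal.ofReal (s t)) ≤ ∫⁻ t in Set.Ioc (0 : ℝ) T, R t := by
  by_cases hfin : (∫⁻ t in Set.Ioc (0 : ℝ) T, R t) = ∞
  · rw [hfin]; exact le_top
  rw [lintegral_eq_nnreal]
  refine iSup₂_le fun ψ hψ => ?_
  rw [← SimpleFunc.lintegral_eq_lintegral]
  have hRae : ∀ᵐ t ∂(volume.restrict (Set.Ioc (0 : ℝ) T)), R t < ∞ :=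
    ae_lt_top hR hfin
  have hRint : Integrable (fun t => (R t).toReal) (volume.restrict (Set.Ioc (0 : ℝ) T)) :=
    integrable_toReal_of_lintegral_ne_top hR.aemeasurable hfin
  have hψint : Integrable (fun t => ((ψ t : NNReal) : ℝ)) (volume.restrict (Set.Ioc (0 : ℝ) T)) := by
    have := (ψ.map (fun a : NNReal => (a : ℝ))).integrable_of_isFiniteMeasure
      (μ := volume.restrict (Set.Ioc (0 : ℝ) T))
    simpa [SimpleFunc.coe_map, Function.comp_def] using this
  classical
  let φ : ℝ → ℝ := fun t => if R t = ∞ then V' t else (R t).toReal - ψ t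
  have hφae : (fun t => (R t).toReal - (ψ t : ℝ)) =ᵐ[volume.restrict (Set.Ioc (0 : ℝ) T)] φ := by
    filter_upwards [hRae] with t ht
    simp [φ, ht.ne]
  have hφint : Integrable φ (volume.restrict (Set.Ioc (0 : ℝ) T)) :=
    (hRint.sub hψint).congr hφae
  have key : V T - V 0 ≤ ∫ t in (0 : ℝ)..T, φ t := by
    refine intervalIntegral.sub_le_integral_of_hasDeriv_right_of_le hT
      (fun t ht => (hV t ht).continuousWithinAt) (g' := V') ?_ ?_ ?_
    · intro t ht
      have h1 := hV t ⟨ht.1.le, ht.2.le⟩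
      exact (h1.hasDerivAt (Icc_mem_nhds ht.1 ht.2)).hasDerivWithinAt
    · rw [integrableOn_Icc_iff_integrableOn_Ioc]; exact hφint
    · intro t _
      by_cases h : R t = ∞
      · simp [φ, h]
      · simp only [φ, h, if_false]
        have h1 := (ENNReal.ofReal_le_iff_le_toReal h).1 (hle t)
        have h2 : (ψ t : ℝ) ≤ s t := by
          have := hψ t
          rw [← ENNReal.ofReal_coe_nnreal] at this
          exact (ENNReal.ofReal_le_ofReal_iff (hs t)).1 this
        linarith
  rw [intervalIntegral.integral_of_le hT, ← integral_congr_ae hφae,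
    integral_sub hRint hψint, integral_toReal hR.aemeasurable hRae] at key
  simp only [SimpleFunc.coe_map, Function.comp_def]
  rw [lintegral_coe_eq_integral _ hψint]
  refine ENNReal.ofReal_le_of_le_toReal ?_
  linarith

theorem hasDeriv_quad {n : ℕ} (Q : Matrix (Fin n) (Fin n) ℝ) (hQ : Qᵀ = Q)
    (w : ℝ → Fin n → ℝ) (w' : Fin n → ℝ) (S : Set ℝ) (t : ℝ) (h : HasDerivWithinAt w w' S t) :
    HasDerivWithinAt (fun s => w s ⬝ᵥ Q.mulVec (w s)) (2 * (w t ⬝ᵥ Q.mulVec w')) S t := by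
  have hi := hasDerivWithinAt_pi.1 h
  have h1 : HasDerivWithinAt (fun s => w s ⬝ᵥ Q.mulVec (w s))
      (w' ⬝ᵥ Q.mulVec (w t) + w t ⬝ᵥ Q.mulVec w') S t := by
    simp only [dotProduct, mulVec, ← Finset.sum_add_distrib]
    exact HasDerivWithinAt.fun_sum fun i _ => (hi i).mul
      (HasDerivWithinAt.fun_sum fun j _ => (hi j).const_mul (Q i j))
  have h2 : w' ⬝ᵥ Q.mulVec (w t) = w t ⬝ᵥ Q.mulVec w' := by
    rw [dotProduct_mulVec, ← mulVec_transpose, hQ, dotProduct_comm]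
  rw [h2, ← two_mul] at h1
  exact h1

/-- Theorem 5 (continuous time): the simulation error is bounded by the
integral of the global RIE over the data, in the extended reals. -/
theorem simulation_error_le_integral_global_RIE_ct
    {n m k : ℕ} (T : ℝ) (hT : 0 ≤ T)
    (Q : Matrix (Fin n) (Fin n) ℝ) (hQ : Q.PosDef)
    (e : (Fin n → ℝ) → (Fin n → ℝ)) (f : (Fin n → ℝ) → (Fin m → ℝ) → (Fin n → ℝ))
    (g : (Fin n → ℝ) → (Fin m → ℝ) → (Fin k → ℝ))
    (he : ContDiff ℝ 1 e)
    (hf : ContDiff ℝ 1 (fun p : (Fin n → ℝ) × (Fin m → ℝ) => f p.1 p.2))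
    (hg : ContDiff ℝ 1 (fun p : (Fin n → ℝ) × (Fin m → ℝ) => g p.1 p.2))
    (E : (Fin n → ℝ) → Matrix (Fin n) (Fin n) ℝ)
    (hE : ∀ ξ, HasFDerivAt e (LinearMap.toContinuousLinearMap (Matrix.mulVecLin (E ξ))) ξ)
    (hEinv : ∀ ξ, IsUnit (E ξ))
    -- signal data on `[0, T]`
    (xd : ℝ → Fin n → ℝ) (vd : ℝ → Fin n → ℝ)
    (ud : ℝ → Fin m → ℝ) (yd : ℝ → Fin k → ℝ)
    (hxd : ∀ t, HasDerivAt xd (vd t) t) (hvd : Continuous vd)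
    (hud : Continuous ud) (hyd : Continuous yd)
    -- the simulated solution of the model with input `ud` and `x(0) = x̃(0)`
    (x : ℝ → Fin n → ℝ) (y : ℝ → Fin k → ℝ)
    (hx0 : x 0 = xd 0)
    (hxdyn : ∀ t ∈ Set.Icc (0 : ℝ) T,
      HasDerivWithinAt (fun s => e (x s)) (f (x t) (ud t)) (Set.Icc (0 : ℝ) T) t)
    (hy : ∀ t, y t = g (x t) (ud t)) :
    (∫⁻ t in Set.Ioc (0 : ℝ) T, ENNReal.ofReal ((yd t - y t) ⬝ᵥ (yd t - y t)))
      ≤ ∫⁻ t in Set.Ioc (0 : ℝ) T,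
          ctGlobalRIE Q e f g E (vd t) (xd t) (ud t) (yd t) := by
  have hQt : Qᵀ = Q := by
    have := hQ.isHermitian.eq
    rwa [conjTranspose_eq_transpose_of_trivial] at this
  have hxc : Continuous xd := continuous_iff_continuousAt.2 fun t => (hxd t).continuousAt
  have hEv : ∀ t, (E (xd t)).mulVec (vd t) = fderiv ℝ e (xd t) (vd t) := by
    intro t
    rw [(hE (xd t)).fderiv]
    rfl
  have hEc : Continuous fun t => (E (xd t)).mulVec (vd t) := by
    simp only [hEv]
    exact ((he.continuous_fderiv one_ne_zero).comp hxc).clm_apply hvd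
  have hec := he.continuous
  have hmeas : Measurable fun t => ctGlobalRIE Q e f g E (vd t) (xd t) (ud t) (yd t) := by
    refine LowerSemicontinuous.measurable ?_
    unfold ctGlobalRIE
    refine lowerSemicontinuous_iSup fun Δ => Continuous.lowerSemicontinuous ?_
    have hfc : Continuous fun t => f (xd t + Δ) (ud t) :=
      hf.continuous.comp ((hxc.add continuous_const).prodMk hud)
    have hgc : Continuous fun t => g (xd t + Δ) (ud t) :=
      hg.continuous.comp ((hxc.add continuous_const).prodMk hud)
    have hec' : Continuous fun t => e (xd t + Δ) - e (xd t) :=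
      (hec.comp (hxc.add continuous_const)).sub (hec.comp hxc)
    refine ENNReal.continuous_ofReal.comp ?_
    refine (continuous_const.mul (hec'.dotProduct
      (continuous_const.matrix_mulVec (hfc.sub hEc)))).add ?_
    exact (hgc.sub hyd).dotProduct (hgc.sub hyd)
  refine lintegral_aux T hT
    (fun t => (e (x t) - e (xd t)) ⬝ᵥ Q.mulVec (e (x t) - e (xd t)))
    (fun t => 2 * ((e (x t) - e (xd t)) ⬝ᵥ
      Q.mulVec (f (x t) (ud t) - (E (xd t)).mulVec (vd t))))
    (fun t => (yd t - y t) ⬝ᵥ (yd t - y t)) _ hmeas ?_ ?_ ?_ ?_ ?_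
  · intro t ht
    refine hasDeriv_quad Q hQt (fun s => e (x s) - e (xd s)) _ _ t ?_
    refine (hxdyn t ht).sub ?_
    exact ((hE (xd t)).comp_hasDerivAt t (hxd t)).hasDerivWithinAt
  · simp [hx0]
  · simpa using hQ.posSemidef.dotProduct_mulVec_nonneg (e (x T) - e (xd T))
  · intro t
    exact Finset.sum_nonneg fun i _ => mul_self_nonneg _
  · intro t
    unfold ctGlobalRIE
    refine le_iSup_of_le (x t - xd t) (le_of_eq ?_)
    have h1 : (yd t - y t) = -(g (x t) (ud t) - yd t) := by rw [hy, neg_sub]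
    rw [add_sub_cancel, h1, neg_dotProduct_neg]
end

section
/- Let Q be a symmetric positive definite n×n matrix and let e, f, g be continuously differentiable with Jacobians (in x) E(x), F(x,u), G(x,u). Let x̃ : [0,T] → ℝⁿ be continuously differentiable with ṽ(t) := (d/dt)x̃(t), ũ, ỹ continuous, and define ε_x(z̃) := f(x̃,ũ) − E(x̃)ṽ and ε_y(z̃) := g(x̃,ũ) − ỹ. Let Δ̃ : [0,T] → ℝⁿ satisfy Δ̃(0) = 0 and (d/dt)[E(x̃(t)) Δ̃(t)] = F(x̃(t),ũ(t)) Δ̃(t) + ε_x(z̃(t)). Then the linearized simulation error satisfies ∫₀ᵀ |G(x̃(t),ũ(t)) Δ̃(t) + ε_y(z̃(t))|² dt ≤ ∫₀ᵀ 𝓔⁰_Q(z̃(t)) dt in the extended reals, where 𝓔⁰_Q(z̃) := sup_{Δ∈ℝⁿ} { 2 (E(x̃)Δ)ᵀ Q (F(x̃,ũ)Δ + ε_x) + |G(x̃,ũ)Δ + ε_y|² }. -/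
open Matrix MeasureTheory ENNReal

/-- Continuous-time local robust identification error at a data point with
Jacobians `E, F, G` and equation errors `ex, ey` (an extended-nonnegative
value; the supremand is nonnegative at `Δ = 0`, so no truncation occurs). -/
noncomputable def ctLocalRIE {n k : ℕ} (Q : Matrix (Fin n) (Fin n) ℝ)
    (E F : Matrix (Fin n) (Fin n) ℝ) (G : Matrix (Fin k) (Fin n) ℝ)
    (ex : Fin n → ℝ) (ey : Fin k → ℝ) : ℝ≥0∞ :=
  ⨆ Δ : Fin n → ℝ,
    ENNReal.ofReal
      (2 * ((E.mulVec Δ) ⬝ᵥ Q.mulVec (F.mulVec Δ + ex))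
        + (G.mulVec Δ + ey) ⬝ᵥ (G.mulVec Δ + ey))

theorem aux_deriv {n : ℕ} (Q : Matrix (Fin n) (Fin n) ℝ) (hQ : Q.PosDef)
    (S : ℝ → Fin n → ℝ) (S' : Fin n → ℝ) (s : Set ℝ) (t : ℝ)
    (h : HasDerivWithinAt S S' s t) :
    HasDerivWithinAt (fun r => S r ⬝ᵥ Q.mulVec (S r)) (2 * (S t ⬝ᵥ Q.mulVec S')) s t := by
  have h1 : HasDerivWithinAt (fun r => Q.mulVec (S r)) (Q.mulVec S') s t :=
    (LinearMap.toContinuousLinearMap (Matrix.mulVecLin Q)).hasFDerivAt.comp_hasDerivWithinAt t h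
  rw [hasDerivWithinAt_pi] at h h1
  have h2 := HasDerivWithinAt.fun_sum (u := Finset.univ) (fun i _ => (h i).mul (h1 i))
  have hs : S' ⬝ᵥ Q.mulVec (S t) = S t ⬝ᵥ Q.mulVec S' := by
    have hT : Qᵀ = Q := by simpa using hQ.isHermitian.eq
    rw [Matrix.dotProduct_mulVec, dotProduct_comm, ← Matrix.mulVec_transpose, hT]
  have h3 : 2 * (S t ⬝ᵥ Q.mulVec S')
      = ∑ i, (S' i * (Q.mulVec (S t)) i + S t i * (Q.mulVec S') i) := by
    rw [Finset.sum_add_distrib, two_mul]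
    nth_rewrite 1 [← hs]
    rfl
  rw [h3]
  exact h2

theorem aux_main (T : ℝ) (hT : 0 ≤ T) (W w h : ℝ → ℝ) (R : ℝ → ℝ≥0∞)
    (hW0 : W 0 = 0) (hWT : 0 ≤ W T) (hh : ∀ t, 0 ≤ h t)
    (hW : ∀ t ∈ Set.Icc (0 : ℝ) T, HasDerivWithinAt W (w t) (Set.Icc (0 : ℝ) T) t)
    (hR : ∀ t, ENNReal.ofReal (w t + h t) ≤ R t) :
    (∫⁻ t in Set.Ioc (0 : ℝ) T, ENNReal.ofReal (h t)) ≤ ∫⁻ t in Set.Ioc (0 : ℝ) T, R t := by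
  have hWd : ∀ t ∈ Set.Ioo (0 : ℝ) T, HasDerivAt W (w t) t := fun t ht =>
    (hW t (Set.Ioo_subset_Icc_self ht)).hasDerivAt (Icc_mem_nhds ht.1 ht.2)
  rw [lintegral_eq_nnreal]
  refine iSup₂_le fun φ hφ => ?_
  rw [← SimpleFunc.lintegral_eq_lintegral]
  set μ := volume.restrict (Set.Ioc (0 : ℝ) T) with hμ
  have hφh : ∀ t, (φ t : ℝ) ≤ h t := fun t => by
    have := hφ t
    rw [← ENNReal.ofReal_coe_nnreal, ENNReal.ofReal_le_ofReal_iff (hh t)] at this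
    exact this
  have hmφ : Measurable (fun t => (φ t : ℝ)) := φ.measurable.coe_nnreal_real
  let ψ : ℝ → ℝ := fun t => max (φ t + deriv W t) 0
  have hmψ : Measurable ψ := (hmφ.add (measurable_deriv W)).max measurable_const
  have hψR : ∫⁻ t, ENNReal.ofReal (ψ t) ∂μ ≤ ∫⁻ t, R t ∂μ := by
    rw [hμ, ← restrict_Ioo_eq_restrict_Ioc]
    refine setLIntegral_mono' measurableSet_Ioo fun t ht => le_trans ?_ (hR t)
    simp only [ψ, (hWd t ht).deriv, ENNReal.ofReal_max, ENNReal.ofReal_zero]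
    refine max_le (ENNReal.ofReal_le_ofReal (by linarith [hφh t])) zero_le
  refine le_trans ?_ hψR
  by_cases htop : ∫⁻ t, ENNReal.ofReal (ψ t) ∂μ = ⊤
  · rw [htop]; exact le_top
  have hψ0 : ∀ t, 0 ≤ ψ t := fun t => le_max_right _ _
  have hψi : Integrable ψ μ :=
    (lintegral_ofReal_ne_top_iff_integrable hmψ.aestronglyMeasurable
      (Filter.Eventually.of_forall hψ0)).1 htop
  have hφi : Integrable (fun t => (φ t : ℝ)) μ := by
    obtain ⟨C, hC⟩ := (φ.finite_range.image (fun x : NNReal => (x : ℝ))).bddAbove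
    refine Integrable.of_bound hmφ.aestronglyMeasurable C (Filter.Eventually.of_forall fun t => ?_)
    rw [Real.norm_of_nonneg (φ t).coe_nonneg]
    exact hC ⟨φ t, ⟨t, rfl⟩, rfl⟩
  have key := intervalIntegral.sub_le_integral_of_hasDeriv_right_of_le (g := W) (g' := w)
    (φ := fun t => ψ t - φ t) hT (fun t ht => (hW t ht).continuousWithinAt)
    (fun t ht => (hWd t ht).hasDerivWithinAt)
    (by rw [integrableOn_Icc_iff_integrableOn_Ioc]; exact hψi.sub hφi)
    (fun t ht => by
      have : φ t + deriv W t ≤ ψ t := le_max_left _ _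
      rw [(hWd t ht).deriv] at this
      linarith)
  rw [intervalIntegral.integral_of_le hT, integral_sub hψi hφi] at key
  have e1 : ∫⁻ t, (φ.map ((↑) : NNReal → ℝ≥0∞)) t ∂μ = ENNReal.ofReal (∫ t, (φ t : ℝ) ∂μ) := by
    rw [ofReal_integral_eq_lintegral_ofReal hφi (Filter.Eventually.of_forall fun t => (φ t).coe_nonneg)]
    simp
  rw [e1, ← ofReal_integral_eq_lintegral_ofReal hψi (Filter.Eventually.of_forall hψ0)]
  exact ENNReal.ofReal_le_ofReal (by linarith)

/-- Theorem 6 (continuous time): the linearized simulation error is bounded by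
the integral of the local RIE over the data, in the extended reals. -/
theorem linearized_simulation_error_le_integral_local_RIE_ct
    {n m k : ℕ} (T : ℝ) (hT : 0 ≤ T)
    (Q : Matrix (Fin n) (Fin n) ℝ) (hQ : Q.PosDef)
    (e : (Fin n → ℝ) → (Fin n → ℝ)) (f : (Fin n → ℝ) → (Fin m → ℝ) → (Fin n → ℝ))
    (g : (Fin n → ℝ) → (Fin m → ℝ) → (Fin k → ℝ))
    (he : ContDiff ℝ 1 e)
    (hf : ContDiff ℝ 1 (fun p : (Fin n → ℝ) × (Fin m → ℝ) => f p.1 p.2))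
    (hg : ContDiff ℝ 1 (fun p : (Fin n → ℝ) × (Fin m → ℝ) => g p.1 p.2))
    -- Jacobians of `e`, `f`, `g` with respect to the state
    (E : (Fin n → ℝ) → Matrix (Fin n) (Fin n) ℝ)
    (F : (Fin n → ℝ) → (Fin m → ℝ) → Matrix (Fin n) (Fin n) ℝ)
    (G : (Fin n → ℝ) → (Fin m → ℝ) → Matrix (Fin k) (Fin n) ℝ)
    (hE : ∀ ξ, HasFDerivAt e (LinearMap.toContinuousLinearMap (Matrix.mulVecLin (E ξ))) ξ)
    (hF : ∀ ξ υ, HasFDerivAt (fun ζ => f ζ υ)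
      (LinearMap.toContinuousLinearMap (Matrix.mulVecLin (F ξ υ))) ξ)
    (hG : ∀ ξ υ, HasFDerivAt (fun ζ => g ζ υ)
      (LinearMap.toContinuousLinearMap (Matrix.mulVecLin (G ξ υ))) ξ)
    -- signal data on `[0, T]`
    (xd : ℝ → Fin n → ℝ) (vd : ℝ → Fin n → ℝ)
    (ud : ℝ → Fin m → ℝ) (yd : ℝ → Fin k → ℝ)
    (hxd : ∀ t, HasDerivAt xd (vd t) t) (hvd : Continuous vd)
    (hud : Continuous ud) (hyd : Continuous yd)
    -- the linearized error signal `Δ̃`, with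
    -- `(d/dt)[E(x̃(t))Δ̃(t)] = F(x̃(t),ũ(t))Δ̃(t) + ε_x(z̃(t))`, `Δ̃(0) = 0`
    (Δ : ℝ → Fin n → ℝ)
    (hΔ0 : Δ 0 = 0)
    (hΔ : ∀ t ∈ Set.Icc (0 : ℝ) T,
      HasDerivWithinAt (fun s => (E (xd s)).mulVec (Δ s))
        ((F (xd t) (ud t)).mulVec (Δ t) + (f (xd t) (ud t) - (E (xd t)).mulVec (vd t)))
        (Set.Icc (0 : ℝ) T) t) :
    (∫⁻ t in Set.Ioc (0 : ℝ) T,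
        ENNReal.ofReal
          (((G (xd t) (ud t)).mulVec (Δ t) + (g (xd t) (ud t) - yd t)) ⬝ᵥ
           ((G (xd t) (ud t)).mulVec (Δ t) + (g (xd t) (ud t) - yd t))))
      ≤ ∫⁻ t in Set.Ioc (0 : ℝ) T,
          ctLocalRIE Q (E (xd t)) (F (xd t) (ud t)) (G (xd t) (ud t))
            (f (xd t) (ud t) - (E (xd t)).mulVec (vd t)) (g (xd t) (ud t) - yd t) := by
  have hsq : ∀ v : Fin k → ℝ, 0 ≤ v ⬝ᵥ v := fun v => Finset.sum_nonneg fun i _ => mul_self_nonneg _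
  refine aux_main T hT (fun t => (E (xd t)).mulVec (Δ t) ⬝ᵥ Q.mulVec ((E (xd t)).mulVec (Δ t)))
    (fun t => 2 * ((E (xd t)).mulVec (Δ t) ⬝ᵥ Q.mulVec ((F (xd t) (ud t)).mulVec (Δ t)
      + (f (xd t) (ud t) - (E (xd t)).mulVec (vd t))))) _ _ ?_ ?_ (fun t => hsq _) ?_ ?_
  · simp [hΔ0]
  · simpa using hQ.posSemidef.dotProduct_mulVec_nonneg ((E (xd T)).mulVec (Δ T))
  · intro t ht
    exact aux_deriv Q hQ _ _ _ t (hΔ t ht)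
  · intro t
    exact le_iSup (fun D : Fin n → ℝ => ENNReal.ofReal
      (2 * (((E (xd t)).mulVec D) ⬝ᵥ Q.mulVec ((F (xd t) (ud t)).mulVec D
        + (f (xd t) (ud t) - (E (xd t)).mulVec (vd t))))
        + ((G (xd t) (ud t)).mulVec D + (g (xd t) (ud t) - yd t)) ⬝ᵥ
          ((G (xd t) (ud t)).mulVec D + (g (xd t) (ud t) - yd t)))) (Δ t)
end

section
/- Let A be an n×n real Hurwitz matrix (all eigenvalues of A have strictly negative real part) and let G be a k×n real matrix. Then there exist n×n real matrices E, F and a symmetric positive definite matrix Q such that F = EA and the symmetric matrix M := (E+F)ᵀ Q (E+F) + Q⁻¹ − (E−F)ᵀ − (E−F) + 2GᵀG is negative definite. -/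
open Matrix

open scoped Matrix.Norms.L2Operator in
lemma aux_pow_tendsto {R : Type*} [NormedRing R] [NormedAlgebra ℂ R] [CompleteSpace R] (a : R)
    (h : spectralRadius ℂ a < 1) : Filter.Tendsto (fun n : ℕ => a ^ n) Filter.atTop (nhds 0) := by
  obtain ⟨r, hr1, hr2⟩ := ENNReal.lt_iff_exists_nnreal_btwn.1 h
  have hr2' : (r : ℝ) < 1 := by exact_mod_cast hr2
  have ev := (spectrum.pow_norm_pow_one_div_tendsto_nhds_spectralRadius a).eventually_lt_const hr1
  refine squeeze_zero_norm' ?_ (tendsto_pow_atTop_nhds_zero_of_lt_one r.2 hr2')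
  filter_upwards [ev, Filter.eventually_gt_atTop 0] with n hn hn0
  have h1 : ‖a ^ n‖ ^ (1 / n : ℝ) < r := by
    rw [← ENNReal.ofReal_coe_nnreal] at hn
    exact (ENNReal.ofReal_lt_ofReal_iff_of_nonneg (by positivity)).1 hn
  have h2 : (‖a ^ n‖ ^ (1 / n : ℝ)) ^ n = ‖a ^ n‖ := by
    rw [one_div]
    exact Real.rpow_inv_natCast_pow (norm_nonneg _) hn0.ne'
  rw [← h2]
  exact pow_le_pow_left₀ (by positivity) h1.le n

lemma aux_spec {n : ℕ} (A S : Matrix (Fin n) (Fin n) ℂ)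
    (hA : ∀ μ : ℂ, μ ∈ spectrum ℂ A → μ.re < 0) (hS : S * (1 - A) = 1) (l : ℂ)
    (hl : l ∈ spectrum ℂ (S * (1 + A))) : ‖l‖ < 1 := by
  have hSu : IsUnit S := IsUnit.of_mul_eq_one _ hS
  have key : algebraMap ℂ (Matrix (Fin n) (Fin n) ℂ) l - S * (1 + A)
      = S * ((l - 1) • (1 : Matrix (Fin n) (Fin n) ℂ) - (l + 1) • A) := by
    have : algebraMap ℂ (Matrix (Fin n) (Fin n) ℂ) l = l • (S * (1 - A)) := by
      rw [hS, Algebra.algebraMap_eq_smul_one]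
    rw [this, ← mul_smul_comm, ← mul_sub]
    congr 1
    module
  rw [spectrum.mem_iff, key, hSu.mul_left_iff] at hl
  by_cases h : l + 1 = 0
  · exfalso
    apply hl
    rw [h, zero_smul, sub_zero]
    have : l - 1 ≠ 0 := by
      have : l = -1 := by linear_combination h
      rw [this]; norm_num
    exact (isUnit_one).smul (Units.mk0 _ this)
  · have h2 : (l - 1) / (l + 1) ∈ spectrum ℂ A := by
      rw [spectrum.mem_iff]
      intro hu
      apply hl
      have := hu.smul (Units.mk0 _ h)
      convert this using 1
      rw [Units.smul_mk0, smul_sub, Algebra.algebraMap_eq_smul_one, smul_smul, mul_div_cancel₀ _ h]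
    have h3 := hA _ h2
    have h4 : 0 < Complex.normSq (l + 1) := Complex.normSq_pos.2 h
    rw [Complex.div_re, ← add_div, div_lt_iff₀ h4] at h3
    simp only [Complex.sub_re, Complex.add_re, Complex.sub_im, Complex.add_im, Complex.one_re,
      Complex.one_im] at h3
    have h5 : ‖l‖ ^ 2 < 1 := by
      rw [Complex.sq_norm, Complex.normSq_apply]
      nlinarith
    nlinarith [norm_nonneg l]

open scoped Matrix.Norms.L2Operator in
lemma aux_quad {n : ℕ} (C : Matrix (Fin n) (Fin n) ℝ) (hC : ‖C‖ < 1) (x : Fin n → ℝ)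
    (hx : x ≠ 0) : x ⬝ᵥ C.mulVec x < x ⬝ᵥ x := by
  have h1 := C.l2_opNorm_mulVec (WithLp.toLp 2 x)
  have h2 := real_inner_le_norm (WithLp.toLp 2 x) (WithLp.toLp 2 (C.mulVec x))
  have h3 : inner ℝ (WithLp.toLp 2 x) (WithLp.toLp 2 (C.mulVec x)) = x ⬝ᵥ C.mulVec x := by
    simp [EuclideanSpace.inner_eq_star_dotProduct, dotProduct_comm]
  have h4 : inner ℝ (WithLp.toLp 2 x) (WithLp.toLp 2 x) = x ⬝ᵥ x := by
    rw [EuclideanSpace.inner_eq_star_dotProduct]; simp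
  have h5 : 0 < ‖WithLp.toLp 2 x‖ := by
    rw [norm_pos_iff]; simpa using hx
  rw [← h3, ← h4, real_inner_self_eq_norm_mul_norm]
  refine h2.trans_lt ?_
  have h6 : ‖WithLp.toLp 2 (C.mulVec x)‖ ≤ ‖C‖ * ‖WithLp.toLp 2 x‖ := h1
  have h7 : ‖C‖ * ‖WithLp.toLp 2 x‖ < ‖WithLp.toLp 2 x‖ := by nlinarith
  exact mul_lt_mul_of_pos_left (h6.trans_lt h7) h5

lemma aux_unit {n : ℕ} (A : Matrix (Fin n) (Fin n) ℝ)
    (hA : ∀ μ : ℂ, μ ∈ spectrum ℂ (A.map Complex.ofReal) → μ.re < 0) : IsUnit (1 - A).det := by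
  have h : IsUnit (1 - A.map Complex.ofReal) := by
    by_contra h
    have := hA 1 (by rw [spectrum.mem_iff]; simpa using h)
    norm_num at this
  have e : 1 - A.map Complex.ofReal = Complex.ofRealHom.mapMatrix (1 - A) := by
    rw [map_sub, map_one]; rfl
  rw [e, Matrix.isUnit_iff_isUnit_det, ← RingHom.map_det, isUnit_iff_ne_zero] at h
  rw [isUnit_iff_ne_zero]
  rintro h0
  rw [h0] at h
  simp at h

open scoped Matrix.Norms.L2Operator in
lemma aux_real {n : ℕ} (A S : Matrix (Fin n) (Fin n) ℝ)
    (hA : ∀ μ : ℂ, μ ∈ spectrum ℂ (A.map Complex.ofReal) → μ.re < 0) (hS : S * (1 - A) = 1)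
    (hn : n ≠ 0) :
    Filter.Tendsto (fun N : ℕ => (S * (1 + A)) ^ N) Filter.atTop (nhds 0) := by
  haveI : Nonempty (Fin n) := ⟨⟨0, Nat.pos_of_ne_zero hn⟩⟩
  set f := (Complex.ofRealHom.mapMatrix : Matrix (Fin n) (Fin n) ℝ →+* _)
  have hA' : ∀ μ : ℂ, μ ∈ spectrum ℂ (f A) → μ.re < 0 := hA
  have hS' : f S * (1 - f A) = 1 := by
    rw [← map_one f, ← map_sub, ← map_mul, hS]
  have h1 := aux_spec _ _ hA' hS'
  have h2 : spectralRadius ℂ (f S * (1 + f A)) < (1 : NNReal) :=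
    spectrum.spectralRadius_lt_of_forall_lt _ (fun k hk => h1 k hk)
  have h3 := aux_pow_tendsto _ (by simpa using h2)
  have hc : Continuous (fun M : Matrix (Fin n) (Fin n) ℂ => M.map Complex.re) :=
    Continuous.matrix_map continuous_id Complex.continuous_re
  have h4 := (hc.tendsto 0).comp h3
  convert h4 using 1
  · funext N
    have : (f S * (1 + f A)) ^ N = f ((S * (1 + A)) ^ N) := by
      rw [map_pow, map_mul, map_add, map_one]
    simp only [Function.comp, this]
    ext i j
    simp [f]
  · simp

open scoped Matrix.Norms.L2Operator in
theorem aux_main_s11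
    {n k : ℕ} (A : Matrix (Fin n) (Fin n) ℝ)
    (hA : ∀ μ : ℂ, μ ∈ spectrum ℂ (A.map Complex.ofReal) → μ.re < 0)
    (G : Matrix (Fin k) (Fin n) ℝ) (hn : n ≠ 0) :
    ∃ (E F Q : Matrix (Fin n) (Fin n) ℝ), Q.PosDef ∧ F = E * A ∧
      ∀ Δ : Fin n → ℝ, Δ ≠ 0 →
        Δ ⬝ᵥ ((E + F)ᵀ * Q * (E + F) + Q⁻¹ - (E - F)ᵀ - (E - F)
          + (2 : ℝ) • (Gᵀ * G)).mulVec Δ < 0 := by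
  have hS : (1 - A)⁻¹ * (1 - A) = 1 := Matrix.nonsing_inv_mul _ (aux_unit A hA)
  set S := (1 - A)⁻¹
  have ht := aux_real A S hA hS hn
  set B := S * (1 + A) with hB
  set W : Matrix (Fin n) (Fin n) ℝ := 1 + (2 : ℝ) • (Gᵀ * G) with hWdef
  have hW : W.PosDef := by
    refine Matrix.PosDef.one.add_posSemidef ?_
    have : (Gᵀ * G).PosSemidef := by
      simpa using Matrix.posSemidef_conjTranspose_mul_self G
    exact this.smul (by norm_num)
  have hC : Filter.Tendsto (fun N : ℕ => (B ^ N)ᵀ * W * B ^ N) Filter.atTop (nhds 0) := by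
    have hc : Continuous (fun M : Matrix (Fin n) (Fin n) ℝ => Mᵀ * W * M) := by fun_prop
    have := (hc.tendsto 0).comp ht
    simpa [Function.comp_def] using this
  have hev := hC.norm.eventually_lt_const (u := 1) (by simp)
  obtain ⟨N, hN, hN0⟩ := (hev.and (Filter.eventually_gt_atTop 0)).exists
  set P := ∑ i ∈ Finset.range N, (B ^ i)ᵀ * W * B ^ i with hP
  have hps : ∀ i, ((B ^ i)ᵀ * W * B ^ i).PosSemidef := fun i => by
    simpa using hW.posSemidef.conjTranspose_mul_mul_same (B ^ i)
  have hPd : P.PosDef := by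
    obtain ⟨m, rfl⟩ : ∃ m, N = m + 1 := ⟨N - 1, by omega⟩
    rw [hP, Finset.sum_range_succ']
    refine Matrix.PosDef.posSemidef_add (Matrix.posSemidef_sum _ fun i _ => hps _) ?_
    simpa using hW
  have hPT : Pᵀ = P := by simpa using hPd.isHermitian.eq
  have hPdet : IsUnit P.det := (Matrix.isUnit_iff_isUnit_det _).1 hPd.isUnit
  have htel : Bᵀ * P * B - P = (B ^ N)ᵀ * W * B ^ N - W := by
    have : Bᵀ * P * B = ∑ i ∈ Finset.range N, (B ^ (i + 1))ᵀ * W * B ^ (i + 1) := by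
      rw [hP, Finset.mul_sum, Finset.sum_mul]
      refine Finset.sum_congr rfl fun i _ => ?_
      rw [pow_succ, Matrix.transpose_mul (B ^ i) B]
      simp only [Matrix.mul_assoc]
    rw [this, hP, ← Finset.sum_sub_distrib,
      Finset.sum_range_sub (fun i => (B ^ i)ᵀ * W * B ^ i)]
    simp
  refine ⟨P * S, P * S * A, P⁻¹, hPd.inv, rfl, fun x hx => ?_⟩
  have e1 : P * S + P * S * A = P * B := by
    rw [hB]; noncomm_ring
  have e2 : P * S - P * S * A = P := by
    calc P * S - P * S * A = P * (S * (1 - A)) := by noncomm_ring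
      _ = P := by rw [hS, mul_one]
  have e3 : (P * B)ᵀ * P⁻¹ * (P * B) = Bᵀ * P * B := by
    rw [Matrix.transpose_mul, hPT, Matrix.mul_assoc Bᵀ, Matrix.mul_nonsing_inv _ hPdet]
    simp only [Matrix.mul_assoc, Matrix.one_mul]
  rw [e1, e2, e3, hPT, Matrix.nonsing_inv_nonsing_inv _ hPdet]
  have e4 : Bᵀ * P * B + P - P - P + (2 : ℝ) • (Gᵀ * G) = (B ^ N)ᵀ * W * B ^ N - 1 := by
    have : Bᵀ * P * B + P - P - P + (2 : ℝ) • (Gᵀ * G)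
      = (Bᵀ * P * B - P) + (2 : ℝ) • (Gᵀ * G) := by abel
    rw [this, htel]
    nth_rewrite 2 [hWdef]
    abel
  rw [e4, Matrix.sub_mulVec, dotProduct_sub, Matrix.one_mulVec]
  have := aux_quad _ hN x hx
  linarith

/-- Lemma 2 (continuous time): for any Hurwitz matrix `A` and any `G`, there
exist `E`, `F` and a symmetric positive definite `Q` with `F = EA` such that
`M = (E+F)ᵀQ(E+F) + Q⁻¹ − (E−F)ᵀ − (E−F) + 2GᵀG` is negative definite. -/
theorem hurwitz_exists_EFQ_negdef
    {n k : ℕ} (A : Matrix (Fin n) (Fin n) ℝ)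
    (hA : ∀ μ : ℂ, μ ∈ spectrum ℂ (A.map Complex.ofReal) → μ.re < 0)
    (G : Matrix (Fin k) (Fin n) ℝ) :
    ∃ (E F Q : Matrix (Fin n) (Fin n) ℝ), Q.PosDef ∧ F = E * A ∧
      ∀ Δ : Fin n → ℝ, Δ ≠ 0 →
        Δ ⬝ᵥ ((E + F)ᵀ * Q * (E + F) + Q⁻¹ - (E - F)ᵀ - (E - F)
          + (2 : ℝ) • (Gᵀ * G)).mulVec Δ < 0 := by
  by_cases hn : n = 0
  · subst hn
    exact ⟨0, 0, 1, Matrix.PosDef.one, by simp, fun x hx => absurd (Subsingleton.elim _ _) hx⟩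
  · exact aux_main_s11 A hA G hn
end

section
/- Let Q be a symmetric positive definite n×n matrix with P := Q⁻¹, and let e : ℝⁿ → ℝⁿ, f : ℝⁿ×ℝᵐ → ℝⁿ, g : ℝⁿ×ℝᵐ → ℝᵏ. For a data point z̃ = (ṽ, x̃, ũ, ỹ), define δ_v := f(x̃+Δ,ũ) − e(ṽ), δ_e := e(x̃+Δ) − e(x̃), δ_y := g(x̃+Δ,ũ) − ỹ. Then the discrete-time global RIE 𝓔_Q(z̃) := sup_Δ { |δ_v|²_Q − |δ_e|²_Q + |δ_y|² } satisfies 𝓔_Q(z̃) ≤ 𝓔̂_Q(z̃) := sup_Δ { |δ_v|²_Q + |Δ|²_P − 2Δᵀδ_e + |δ_y|² }, in the extended reals. -/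
open Matrix

theorem quad_aux {n : ℕ} (Q : Matrix (Fin n) (Fin n) ℝ) (hQ : Q.PosDef) (a d : Fin n → ℝ) :
    0 ≤ quadForm Q⁻¹ a - 2 * (a ⬝ᵥ d) + quadForm Q d := by
  have h0 := hQ.posSemidef.dotProduct_mulVec_nonneg (Q⁻¹ *ᵥ a - d)
  have hu : IsUnit Q.det := (Matrix.isUnit_iff_isUnit_det Q).1 hQ.isUnit
  have h1 : Q *ᵥ (Q⁻¹ *ᵥ a) = a := by
    rw [Matrix.mulVec_mulVec, Matrix.mul_nonsing_inv _ hu, Matrix.one_mulVec]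
  have hT : Qᵀ = Q := by
    have h := hQ.isHermitian.eq
    rwa [Matrix.conjTranspose_eq_transpose_of_trivial] at h
  have h2 : (Q⁻¹ *ᵥ a) ⬝ᵥ (Q *ᵥ d) = a ⬝ᵥ d := by
    rw [Matrix.dotProduct_mulVec, ← Matrix.mulVec_transpose, hT, h1]
  rw [star_trivial, Matrix.mulVec_sub, h1, sub_dotProduct, dotProduct_sub, dotProduct_sub, h2,
    dotProduct_comm _ a, dotProduct_comm d a] at h0
  unfold quadForm
  linarith

/-- The discrete-time global RIE is bounded by its convex upper bound
`𝓔̂_Q` (with `P = Q⁻¹`), in the extended reals. -/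
theorem global_RIE_le_convex_upper_bound_dt
    {n m k : ℕ} (Q : Matrix (Fin n) (Fin n) ℝ) (hQ : Q.PosDef)
    (e : (Fin n → ℝ) → (Fin n → ℝ)) (f : (Fin n → ℝ) → (Fin m → ℝ) → (Fin n → ℝ))
    (g : (Fin n → ℝ) → (Fin m → ℝ) → (Fin k → ℝ))
    -- the data point `z̃ = (v, x, u, yy)`
    (v x : Fin n → ℝ) (u : Fin m → ℝ) (yy : Fin k → ℝ) :
    (⨆ Δ : Fin n → ℝ,
      ((quadForm Q (f (x + Δ) u - e v) - quadForm Q (e (x + Δ) - e x)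
        + (g (x + Δ) u - yy) ⬝ᵥ (g (x + Δ) u - yy) : ℝ) : EReal))
      ≤ ⨆ Δ : Fin n → ℝ,
          ((quadForm Q (f (x + Δ) u - e v) + quadForm Q⁻¹ Δ
            - 2 * (Δ ⬝ᵥ (e (x + Δ) - e x))
            + (g (x + Δ) u - yy) ⬝ᵥ (g (x + Δ) u - yy) : ℝ) : EReal) := by
  refine iSup_mono fun Δ => ?_
  rw [EReal.coe_le_coe_iff]
  have := quad_aux Q hQ Δ (e (x + Δ) - e x)
  linarith
end

section
/- Let Q be a symmetric positive definite n×n matrix with P := Q⁻¹, let e, f, g be continuously differentiable with E(x) the Jacobian of e. For a data point z̃ = (ṽ, x̃, ũ, ỹ), define δ_e := e(x̃+Δ) − e(x̃), δ_y := g(x̃+Δ,ũ) − ỹ, δ_e⁺ := δ_e + f(x̃+Δ,ũ) − E(x̃)ṽ, and δ_e⁻ := δ_e − f(x̃+Δ,ũ) + E(x̃)ṽ. Then the identity 4 δ_eᵀ Q (f(x̃+Δ,ũ) − E(x̃)ṽ) = |δ_e⁺|²_Q − |δ_e⁻|²_Q holds for every Δ, and the continuous-time global RIE 𝓔_Q(z̃)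 := sup_Δ { 2 δ_eᵀ Q (f(x̃+Δ,ũ) − E(x̃)ṽ) + |δ_y|² } satisfies 𝓔_Q(z̃) ≤ 𝓔̂_Q(z̃) := sup_Δ { (|δ_e⁺|²_Q + |Δ|²_P)/2 − Δᵀδ_e⁻ + |δ_y|² }, in the extended reals. -/
open Matrix

theorem dot_symm_aux {n : ℕ} (Q : Matrix (Fin n) (Fin n) ℝ) (hQ : Q.PosDef)
    (a b : Fin n → ℝ) : a ⬝ᵥ Q.mulVec b = b ⬝ᵥ Q.mulVec a := by
  have h : Qᵀ = Q := by
    have := hQ.isHermitian.eq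
    rwa [Matrix.conjTranspose_eq_transpose_of_trivial] at this
  rw [Matrix.dotProduct_mulVec, ← Matrix.mulVec_transpose, h, dotProduct_comm]

theorem polar_aux {n : ℕ} (Q : Matrix (Fin n) (Fin n) ℝ) (hQ : Q.PosDef)
    (a b : Fin n → ℝ) :
    4 * (a ⬝ᵥ Q.mulVec b) = quadForm Q (a + b) - quadForm Q (a - b) := by
  unfold quadForm
  simp only [Matrix.mulVec_add, Matrix.mulVec_sub, dotProduct_add, add_dotProduct,
    dotProduct_sub, sub_dotProduct]
  rw [dot_symm_aux Q hQ b a]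
  ring

theorem young_aux {n : ℕ} (Q : Matrix (Fin n) (Fin n) ℝ) (hQ : Q.PosDef)
    (d c : Fin n → ℝ) :
    0 ≤ quadForm Q⁻¹ d - 2 * (d ⬝ᵥ c) + quadForm Q c := by
  have hu : IsUnit Q.det := (Matrix.isUnit_iff_isUnit_det Q).mp hQ.isUnit
  have h := hQ.posSemidef.dotProduct_mulVec_nonneg (Q⁻¹.mulVec d - c)
  have h1 : Q.mulVec (Q⁻¹.mulVec d) = d := by
    rw [Matrix.mulVec_mulVec, Matrix.mul_nonsing_inv _ hu, Matrix.one_mulVec]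
  have h2 := dot_symm_aux Q hQ (Q⁻¹.mulVec d) c
  rw [h1] at h2
  simp only [star_trivial, Matrix.mulVec_sub, dotProduct_sub, sub_dotProduct, h1, h2] at h
  unfold quadForm
  rw [dotProduct_comm d (Q⁻¹.mulVec d), dotProduct_comm d c]
  linarith

/-- The identity `4δ_eᵀQ(f(x̃+Δ,ũ) − E(x̃)ṽ) = |δ_e⁺|²_Q − |δ_e⁻|²_Q` and the
resulting bound of the continuous-time global RIE by its convex upper bound
`𝓔̂_Q` (with `P = Q⁻¹`), in the extended reals. -/
theorem global_RIE_le_convex_upper_bound_ct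
    {n m k : ℕ} (Q : Matrix (Fin n) (Fin n) ℝ) (hQ : Q.PosDef)
    (e : (Fin n → ℝ) → (Fin n → ℝ)) (f : (Fin n → ℝ) → (Fin m → ℝ) → (Fin n → ℝ))
    (g : (Fin n → ℝ) → (Fin m → ℝ) → (Fin k → ℝ))
    (he : ContDiff ℝ 1 e)
    (hf : ContDiff ℝ 1 (fun p : (Fin n → ℝ) × (Fin m → ℝ) => f p.1 p.2))
    (hg : ContDiff ℝ 1 (fun p : (Fin n → ℝ) × (Fin m → ℝ) => g p.1 p.2))
    (E : (Fin n → ℝ) → Matrix (Fin n) (Fin n) ℝ)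
    (hE : ∀ ξ, HasFDerivAt e (LinearMap.toContinuousLinearMap (Matrix.mulVecLin (E ξ))) ξ)
    -- the data point `z̃ = (v, x, u, yy)`
    (v x : Fin n → ℝ) (u : Fin m → ℝ) (yy : Fin k → ℝ) :
    (∀ Δ : Fin n → ℝ,
      4 * ((e (x + Δ) - e x) ⬝ᵥ Q.mulVec (f (x + Δ) u - (E x).mulVec v))
        = quadForm Q ((e (x + Δ) - e x) + (f (x + Δ) u - (E x).mulVec v))
          - quadForm Q ((e (x + Δ) - e x) - (f (x + Δ) u - (E x).mulVec v)))
    ∧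
    (⨆ Δ : Fin n → ℝ,
      ((2 * ((e (x + Δ) - e x) ⬝ᵥ Q.mulVec (f (x + Δ) u - (E x).mulVec v))
        + (g (x + Δ) u - yy) ⬝ᵥ (g (x + Δ) u - yy) : ℝ) : EReal))
      ≤ ⨆ Δ : Fin n → ℝ,
          (((quadForm Q ((e (x + Δ) - e x) + (f (x + Δ) u - (E x).mulVec v))
              + quadForm Q⁻¹ Δ) / 2
            - Δ ⬝ᵥ ((e (x + Δ) - e x) - (f (x + Δ) u - (E x).mulVec v))
            + (g (x + Δ) u - yy) ⬝ᵥ (g (x + Δ) u - yy) : ℝ) : EReal) := by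
  refine ⟨fun Δ => polar_aux Q hQ _ _, iSup_mono fun Δ => EReal.coe_le_coe_iff.mpr ?_⟩
  have h1 := polar_aux Q hQ (e (x + Δ) - e x) (f (x + Δ) u - (E x).mulVec v)
  have h2 := young_aux Q hQ Δ ((e (x + Δ) - e x) - (f (x + Δ) u - (E x).mulVec v))
  linarith
end

section
/- Let Q be a symmetric positive definite n×n matrix with P := Q⁻¹, and let e : ℝⁿ → ℝⁿ, f : ℝⁿ×ℝᵐ → ℝⁿ, g : ℝⁿ×ℝᵐ → ℝᵏ be continuously differentiable with Jacobians (in x) E(x), F(x,u), G(x,u), and with E(x) uniformly bounded in operator norm. Suppose that for all x ∈ ℝⁿ, u ∈ ℝᵐ the symmetric matrix R̂(x,u) := F(x,u)ᵀQF(x,u) + P − E(x)ᵀ − E(x) + G(x,u)ᵀG(x,u) is negative semidefinite. Then E(x) + E(x)ᵀ ⪰ P ⪰ λ_min(P)·I > 0 for all x, and consequently e is a bijection from ℝⁿ to ℝⁿ; in particular the discrete-time implicit state equation e(x(t+1)) = f(x(t),u(t)) is well-posed (has a unique solution x(t+1) for every right-hand side). -/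
open Matrix

lemma aux_psd {n : ℕ} (A : Matrix (Fin n) (Fin n) ℝ) (hA : A.IsHermitian) (l : ℝ)
    (hl : ∀ i, l ≤ hA.eigenvalues i) :
    (A - l • (1 : Matrix (Fin n) (Fin n) ℝ)).PosSemidef := by
  have h1 : A - l • (1 : Matrix (Fin n) (Fin n) ℝ) =
      (hA.eigenvectorUnitary : Matrix (Fin n) (Fin n) ℝ) *
        (diagonal (fun i => hA.eigenvalues i - l)) *
        (hA.eigenvectorUnitary : Matrix (Fin n) (Fin n) ℝ)ᴴ := by
    have h2 : (diagonal (fun i => hA.eigenvalues i - l) : Matrix (Fin n) (Fin n) ℝ) =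
        diagonal (RCLike.ofReal ∘ hA.eigenvalues) - l • 1 := by
      rw [← diagonal_one, ← diagonal_smul, diagonal_sub]
      congr 1
      ext i
      simp
    have h3 := hA.spectral_theorem
    rw [Unitary.conjStarAlgAut_apply] at h3
    have h4 : (hA.eigenvectorUnitary : Matrix (Fin n) (Fin n) ℝ) *
      (hA.eigenvectorUnitary : Matrix (Fin n) (Fin n) ℝ)ᴴ = 1 :=
      Unitary.coe_mul_star_self hA.eigenvectorUnitary
    rw [h2, mul_sub, sub_mul, mul_smul_comm, smul_mul_assoc, mul_one, h4]
    congr 1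
  rw [h1]
  refine PosSemidef.mul_mul_conjTranspose_same (PosSemidef.diagonal ?_) _
  intro i
  simpa using hl i

lemma aux_sq_le {n : ℕ} (x : Fin n → ℝ) : ‖x‖ ^ 2 ≤ x ⬝ᵥ x := by
  have h0 : 0 ≤ x ⬝ᵥ x := Finset.sum_nonneg fun i _ => mul_self_nonneg _
  have h : ‖x‖ ≤ Real.sqrt (x ⬝ᵥ x) := by
    rw [pi_norm_le_iff_of_nonneg (Real.sqrt_nonneg _)]
    intro i
    rw [Real.norm_eq_abs]
    apply Real.abs_le_sqrt
    rw [sq]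
    exact Finset.single_le_sum (f := fun i => x i * x i)
      (fun i _ => mul_self_nonneg _) (Finset.mem_univ i)
  calc ‖x‖ ^ 2 ≤ (Real.sqrt (x ⬝ᵥ x)) ^ 2 := by gcongr
    _ = _ := Real.sq_sqrt h0

lemma aux_dot_le {n : ℕ} (x y : Fin n → ℝ) : x ⬝ᵥ y ≤ n * (‖x‖ * ‖y‖) := by
  have : x ⬝ᵥ y ≤ ∑ _i : Fin n, ‖x‖ * ‖y‖ := by
    refine Finset.sum_le_sum fun i _ => ?_
    calc x i * y i ≤ ‖x i * y i‖ := le_abs_self _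
      _ = ‖x i‖ * ‖y i‖ := norm_mul _ _
      _ ≤ _ := by gcongr <;> exact norm_le_pi_norm _ i
  simpa using this

lemma aux_bij {n : ℕ} (e : (Fin n → ℝ) → (Fin n → ℝ))
    (he : ContDiff ℝ 1 e)
    (E : (Fin n → ℝ) → Matrix (Fin n) (Fin n) ℝ)
    (hE : ∀ ξ, HasFDerivAt e (LinearMap.toContinuousLinearMap (Matrix.mulVecLin (E ξ))) ξ)
    (hbdd : ∃ c : ℝ, ∀ ξ,
      ‖LinearMap.toContinuousLinearMap (Matrix.mulVecLin (E ξ))‖ ≤ c)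
    (l : ℝ) (hl : 0 < l) (hEl : ∀ ξ v, l * (v ⬝ᵥ v) ≤ v ⬝ᵥ (E ξ *ᵥ v)) :
    Function.Bijective e := by
  have hmono : ∀ x y, l * ((x - y) ⬝ᵥ (x - y)) ≤ (x - y) ⬝ᵥ (e x - e y) := by
    intro x y
    have hd : ∀ t : ℝ, HasDerivAt (fun t : ℝ => (x - y) ⬝ᵥ e (y + t • (x - y)))
        ((x - y) ⬝ᵥ (E (y + t • (x - y)) *ᵥ (x - y))) t := by
      intro t
      have h1 : HasDerivAt (fun t : ℝ => y + t • (x - y)) (x - y) t := by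
        simpa using ((hasDerivAt_id t).smul_const (x - y)).const_add y
      have h2 := (hE (y + t • (x - y))).comp_hasDerivAt t h1
      have h3 := hasDerivAt_pi.1 h2
      exact HasDerivAt.fun_sum fun i _ => (h3 i).const_mul ((x - y) i)
    obtain ⟨c, -, hc⟩ := exists_hasDerivAt_eq_slope
      (fun t : ℝ => (x - y) ⬝ᵥ e (y + t • (x - y))) _ zero_lt_one
      (fun t _ => (hd t).continuousAt.continuousWithinAt) (fun t _ => hd t)
    have h := hEl (y + c • (x - y)) (x - y)
    rw [hc] at h
    simpa [dotProduct_sub] using h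
  have hnorm : ∀ x y, dist x y ≤ (n / l) * dist (e x) (e y) := by
    intro x y
    rw [dist_eq_norm, dist_eq_norm]
    have h1 := hmono x y
    have h2 := aux_sq_le (x - y)
    have h3 := aux_dot_le (x - y) (e x - e y)
    rcases (norm_nonneg (x - y)).eq_or_lt with h | h
    · rw [← h]; positivity
    · rw [div_mul_eq_mul_div, le_div_iff₀ hl]
      refine le_of_mul_le_mul_left ?_ h
      nlinarith
  have hanti : AntilipschitzWith ⟨n / l, by positivity⟩ e :=
    AntilipschitzWith.of_le_mul_dist hnorm
  obtain ⟨c, hc⟩ := hbdd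
  have hc0 : 0 ≤ c := (norm_nonneg _).trans (hc 0)
  have hlip : LipschitzWith ⟨c, hc0⟩ e := by
    refine lipschitzWith_of_nnnorm_fderiv_le (𝕜 := ℝ) (fun x => (hE x).differentiableAt) fun x => ?_
    rw [(hE x).fderiv]
    exact hc x
  have hcl : IsClosed (Set.range e) := hanti.isClosed_range hlip.uniformContinuous
  have hop : IsOpenMap e := by
    refine isOpenMap_iff_nhds_le.2 fun x => ?_
    have hs : HasStrictFDerivAt e (LinearMap.toContinuousLinearMap (Matrix.mulVecLin (E x))) x := by
      have := he.contDiffAt.hasStrictFDerivAt (x := x) (by norm_num)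
      rwa [(hE x).fderiv] at this
    refine (hs.map_nhds_eq_of_surj ?_).ge
    have hinj : Function.Injective (Matrix.mulVecLin (E x)) := by
      rw [← LinearMap.ker_eq_bot, LinearMap.ker_eq_bot']
      intro v hv
      have h1 := hEl x v
      rw [Matrix.mulVecLin_apply] at hv
      rw [hv, dotProduct_zero] at h1
      have h2 : 0 ≤ v ⬝ᵥ v := Finset.sum_nonneg fun i _ => mul_self_nonneg _
      have h3 : v ⬝ᵥ v = 0 := by nlinarith
      exact dotProduct_self_eq_zero.1 h3
    have := LinearMap.injective_iff_surjective.1 hinj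
    exact LinearMap.range_eq_top.2 this
  refine ⟨hanti.injective, ?_⟩
  rw [← Set.range_eq_univ]
  exact IsClopen.eq_univ ⟨hcl, hop.isOpen_range⟩ (Set.range_nonempty e)

/-- Theorem (well-posedness of discrete-time state dynamics): if
`R̂(x,u) = F(x,u)ᵀQF(x,u) + P − E(x)ᵀ − E(x) + G(x,u)ᵀG(x,u) ⪯ 0` for all
`(x,u)`, where `P = Q⁻¹ ≻ 0`, and the Jacobian `E(x)` is uniformly bounded,
then `E(x) + E(x)ᵀ ⪰ P ⪰ λ_min(P)·I ≻ 0` for all `x`, hence `e` is a bijection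
and the implicit state equation `e(x(t+1)) = f(x(t),u(t))` is well posed. -/
theorem robust_upper_bound_implies_wellposedness_dt
    {n m k : ℕ} (hn : 0 < n)
    (Q : Matrix (Fin n) (Fin n) ℝ) (hQ : Q.PosDef)
    (hP : (Q⁻¹).IsHermitian)
    (e : (Fin n → ℝ) → (Fin n → ℝ)) (f : (Fin n → ℝ) → (Fin m → ℝ) → (Fin n → ℝ))
    (g : (Fin n → ℝ) → (Fin m → ℝ) → (Fin k → ℝ))
    (he : ContDiff ℝ 1 e)
    (hf : ContDiff ℝ 1 (fun p : (Fin n → ℝ) × (Fin m → ℝ) => f p.1 p.2))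
    (hg : ContDiff ℝ 1 (fun p : (Fin n → ℝ) × (Fin m → ℝ) => g p.1 p.2))
    -- Jacobians of `e`, `f`, `g` with respect to the state
    (E : (Fin n → ℝ) → Matrix (Fin n) (Fin n) ℝ)
    (F : (Fin n → ℝ) → (Fin m → ℝ) → Matrix (Fin n) (Fin n) ℝ)
    (G : (Fin n → ℝ) → (Fin m → ℝ) → Matrix (Fin k) (Fin n) ℝ)
    (hE : ∀ ξ, HasFDerivAt e (LinearMap.toContinuousLinearMap (Matrix.mulVecLin (E ξ))) ξ)
    (hF : ∀ ξ υ, HasFDerivAt (fun ζ => f ζ υ)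
      (LinearMap.toContinuousLinearMap (Matrix.mulVecLin (F ξ υ))) ξ)
    (hG : ∀ ξ υ, HasFDerivAt (fun ζ => g ζ υ)
      (LinearMap.toContinuousLinearMap (Matrix.mulVecLin (G ξ υ))) ξ)
    -- `E` uniformly bounded in operator norm
    (hbdd : ∃ c : ℝ, ∀ ξ,
      ‖LinearMap.toContinuousLinearMap (Matrix.mulVecLin (E ξ))‖ ≤ c)
    -- `R̂(x,u)` negative semidefinite for all `(x,u)`
    (hRhat : ∀ (ξ : Fin n → ℝ) (υ : Fin m → ℝ), ∀ Δ : Fin n → ℝ,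
      Δ ⬝ᵥ ((F ξ υ)ᵀ * Q * (F ξ υ) + Q⁻¹ - (E ξ)ᵀ - E ξ
        + (G ξ υ)ᵀ * (G ξ υ)).mulVec Δ ≤ 0) :
    (∀ ξ, (E ξ + (E ξ)ᵀ - Q⁻¹).PosSemidef)
    ∧ (Q⁻¹ - (⨅ i, hP.eigenvalues i) • (1 : Matrix (Fin n) (Fin n) ℝ)).PosSemidef
    ∧ 0 < ⨅ i, hP.eigenvalues i
    ∧ Function.Bijective e
    ∧ ∀ w : Fin n → ℝ, ∃! ξ : Fin n → ℝ, e ξ = w := by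
  haveI : Nonempty (Fin n) := ⟨⟨0, hn⟩⟩
  have hPd : (Q⁻¹).PosDef := hQ.inv
  have hlpos : 0 < ⨅ i, hP.eigenvalues i := by
    obtain ⟨i, hi⟩ := exists_eq_ciInf_of_finite (f := hP.eigenvalues)
    rw [← hi]
    exact hPd.eigenvalues_pos i
  have hlpsd := aux_psd Q⁻¹ hP (⨅ i, hP.eigenvalues i)
    (fun i => ciInf_le (Set.finite_range _).bddBelow i)
  have hq : ∀ ξ v, v ⬝ᵥ (Q⁻¹ *ᵥ v) ≤ 2 * (v ⬝ᵥ (E ξ *ᵥ v)) := by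
    intro ξ v
    have h := hRhat ξ 0 v
    have h1 : 0 ≤ v ⬝ᵥ (((F ξ 0)ᵀ * Q * (F ξ 0)) *ᵥ v) :=
      (hQ.posSemidef.conjTranspose_mul_mul_same (F ξ 0)).dotProduct_mulVec_nonneg v
    have h2 : 0 ≤ v ⬝ᵥ (((G ξ 0)ᵀ * (G ξ 0)) *ᵥ v) :=
      (posSemidef_conjTranspose_mul_self (G ξ 0)).dotProduct_mulVec_nonneg v
    have h3 : v ⬝ᵥ ((E ξ)ᵀ *ᵥ v) = v ⬝ᵥ (E ξ *ᵥ v) := by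
      rw [mulVec_transpose, dotProduct_comm, ← dotProduct_mulVec]
    simp only [add_mulVec, sub_mulVec, dotProduct_add, dotProduct_sub, h3] at h
    linarith
  have hb : Function.Bijective e := by
    refine aux_bij e he E hE hbdd ((⨅ i, hP.eigenvalues i) / 2) (by positivity) fun ξ v => ?_
    have h1 := hq ξ v
    have h2 : 0 ≤ v ⬝ᵥ _ := hlpsd.dotProduct_mulVec_nonneg v
    simp only [sub_mulVec, dotProduct_sub, smul_mulVec, one_mulVec, dotProduct_smul,
      smul_eq_mul] at h2
    linarith
  refine ⟨fun ξ => ?_, hlpsd, hlpos, hb, hb.existsUnique⟩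
  refine PosSemidef.of_dotProduct_mulVec_nonneg ?_ fun v => ?_
  · refine IsHermitian.sub ?_ hP
    exact isHermitian_add_transpose_self (E ξ)
  · have h3 : v ⬝ᵥ ((E ξ)ᵀ *ᵥ v) = v ⬝ᵥ (E ξ *ᵥ v) := by
      rw [mulVec_transpose, dotProduct_comm, ← dotProduct_mulVec]
    have := hq ξ v
    simp only [star_trivial, add_mulVec, sub_mulVec, dotProduct_add, dotProduct_sub, h3]
    linarith
end

section
/- Let Q be a symmetric positive definite n×n matrix with P := Q⁻¹, let E, F be n×n matrices and G a k×n matrix, and suppose the symmetric matrix S := Eᵀ + E − P − FᵀQF − GᵀG is positive definite. Then for any ε_x ∈ ℝⁿ and ε_y ∈ ℝᵏ, the supremum over Δ ∈ ℝⁿ of the concave quadratic function |FΔ + ε_x|²_Q + |Δ|²_P − 2Δᵀ(EΔ) + |GΔ + ε_y|² is attained and equals ε_xᵀQε_x + ε_yᵀε_y + bᵀS⁻¹b, where b := FᵀQε_x + Gᵀε_y. In particular, the convex upper bound 𝓔̂⁰_Q on the local RIE of a linear model is a quadratic form in the equation errors (ε_x, ε_y). -/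
open Matrix

/-- For a linear model, if `S = Eᵀ + E − P − FᵀQF − GᵀG ≻ 0` (with `P = Q⁻¹`),
then the supremum over `Δ` of the concave quadratic
`|FΔ + ε_x|²_Q + |Δ|²_P − 2Δᵀ(EΔ) + |GΔ + ε_y|²` is attained and equals
`ε_xᵀQε_x + ε_yᵀε_y + bᵀS⁻¹b` with `b = FᵀQε_x + Gᵀε_y`. -/
theorem convex_upper_bound_linear_model_value
    {n k : ℕ} (Q : Matrix (Fin n) (Fin n) ℝ) (hQ : Q.PosDef)
    (E F : Matrix (Fin n) (Fin n) ℝ) (G : Matrix (Fin k) (Fin n) ℝ)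
    (hS : (Eᵀ + E - Q⁻¹ - Fᵀ * Q * F - Gᵀ * G).PosDef)
    (ex : Fin n → ℝ) (ey : Fin k → ℝ) :
    IsGreatest
      (Set.range fun Δ : Fin n → ℝ =>
        quadForm Q (F.mulVec Δ + ex) + quadForm Q⁻¹ Δ - 2 * (Δ ⬝ᵥ E.mulVec Δ)
          + (G.mulVec Δ + ey) ⬝ᵥ (G.mulVec Δ + ey))
      (ex ⬝ᵥ Q.mulVec ex + ey ⬝ᵥ ey
        + (Fᵀ.mulVec (Q.mulVec ex) + Gᵀ.mulVec ey) ⬝ᵥ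
          (Eᵀ + E - Q⁻¹ - Fᵀ * Q * F - Gᵀ * G)⁻¹.mulVec
            (Fᵀ.mulVec (Q.mulVec ex) + Gᵀ.mulVec ey)) := by
  have hQt : Qᵀ = Q := by
    have := hQ.isHermitian
    simpa [Matrix.IsHermitian, Matrix.conjTranspose_eq_transpose_of_trivial] using this
  have key : ∀ Δ : Fin n → ℝ,
      quadForm Q (F.mulVec Δ + ex) + quadForm Q⁻¹ Δ - 2 * (Δ ⬝ᵥ E.mulVec Δ)
          + (G.mulVec Δ + ey) ⬝ᵥ (G.mulVec Δ + ey)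
        = ex ⬝ᵥ Q.mulVec ex + ey ⬝ᵥ ey
          + 2 * (Δ ⬝ᵥ (Fᵀ.mulVec (Q.mulVec ex) + Gᵀ.mulVec ey))
          - Δ ⬝ᵥ (Eᵀ + E - Q⁻¹ - Fᵀ * Q * F - Gᵀ * G).mulVec Δ := by
    intro Δ
    have tr : ∀ {m l : ℕ} (A : Matrix (Fin m) (Fin l) ℝ) (x : Fin l → ℝ) (y : Fin m → ℝ),
        x ⬝ᵥ Aᵀ.mulVec y = A.mulVec x ⬝ᵥ y := by
      intro m l A x y
      rw [Matrix.dotProduct_mulVec, Matrix.vecMul_transpose]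
    have h1 : ex ⬝ᵥ Q.mulVec (F.mulVec Δ) = F.mulVec Δ ⬝ᵥ Q.mulVec ex := by
      conv_lhs => rw [← hQt, tr, dotProduct_comm]
    have h2 : ey ⬝ᵥ G.mulVec Δ = G.mulVec Δ ⬝ᵥ ey := dotProduct_comm _ _
    have h3 : E.mulVec Δ ⬝ᵥ Δ = Δ ⬝ᵥ E.mulVec Δ := dotProduct_comm _ _
    simp only [quadForm, Matrix.sub_mulVec, Matrix.add_mulVec, Matrix.mulVec_add,
      dotProduct_add, add_dotProduct, dotProduct_sub, ← Matrix.mulVec_mulVec, tr, h1, h2, h3]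
    ring
  generalize (Eᵀ + E - Q⁻¹ - Fᵀ * Q * F - Gᵀ * G) = S at hS key ⊢
  generalize Fᵀ.mulVec (Q.mulVec ex) + Gᵀ.mulVec ey = b at key ⊢
  have hSt : Sᵀ = S := by
    have := hS.isHermitian
    simpa [Matrix.IsHermitian, Matrix.conjTranspose_eq_transpose_of_trivial] using this
  have hv : S.mulVec (S⁻¹.mulVec b) = b := by
    rw [Matrix.mulVec_mulVec, Matrix.mul_nonsing_inv _ hS.det_pos.ne'.isUnit, Matrix.one_mulVec]
  generalize S⁻¹.mulVec b = v at hv ⊢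
  constructor
  · refine ⟨v, ?_⟩
    simp only [key, hv, dotProduct_comm b v]
    ring
  · rintro _ ⟨Δ, rfl⟩
    simp only [key]
    have hn : 0 ≤ (Δ - v) ⬝ᵥ S.mulVec (Δ - v) := by
      simpa using hS.posSemidef.dotProduct_mulVec_nonneg (Δ - v)
    have h4 : v ⬝ᵥ S.mulVec Δ = Δ ⬝ᵥ b := by
      rw [Matrix.dotProduct_mulVec, ← Matrix.mulVec_transpose, hSt, hv, dotProduct_comm]
    simp only [Matrix.mulVec_sub, dotProduct_sub, sub_dotProduct, hv, h4] at hn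
    rw [dotProduct_comm b v]
    linarith
end
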